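/- arXiv:2004.13302 — 5 statements merged into one kernel-verified Lean document; each statement's English description precedes it below -/
import Mathlib

section
/- Let G be a simple, locally finite graph without isolated vertices and let M ∈ [0,1]^{V(G)×V(G)} be a Markov chain on G, i.e. Σ_{w∈V(G)} M_{v,w} = 1 for every v ∈ V(G), and M_{v,w} > 0 implies {v,w} ∈ E(G). Then the function θ defined by θ({v,w}) := M_{v,w} + M_{w,v} is a threshold weighting on G, and moreover for every finite subgraph F ⊆ G one has Δ_θ(F) = Σ_{v∈V(F)} Σ_{w∈V(G) : {v,w}∉E(F)} M_{v,w}. -/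
open scoped Classical

noncomputable section

namespace Paper

/-- A join-tree: a finite rooted binary tree whose leaves are labeled by
edges (elements of `Sym2 α`) or by `⊥` (here `none`). -/
inductive JoinTree (α : Type*) where
  | leaf : Option (Sym2 α) → JoinTree α
  | node : JoinTree α → JoinTree α → JoinTree α

variable {V : Type*}

/-- The vertex set of a finite edge set (a finite subgraph given by its edges). -/
def vset (F : Finset (Sym2 V)) : Set V := {v | ∃ e ∈ F, v ∈ e}

lemma vset_mono {F F' : Finset (Sym2 V)} (h : F ⊆ F') : vset F ⊆ vset F' := by
  rintro v ⟨e, he, hv⟩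
  exact ⟨e, h he, hv⟩

/-- `Δ_θ(F) = |V(F)| − Σ_{e ∈ E(F)} θ(e)`. -/
def Delta (θ : Sym2 V → ℝ) (F : Finset (Sym2 V)) : ℝ :=
  ((vset F).ncard : ℝ) - ∑ e ∈ F, θ e

/-- `θ` is a threshold weighting on the graph with edge set `E`:
it takes values in `[0,2]` on `E`, `Δ_θ(F) ≥ 0` for every finite subgraph `F ⊆ E`,
and `Δ_θ(E) = 0` whenever `E` is finite. -/
def IsThresholdWeighting (E : Set (Sym2 V)) (θ : Sym2 V → ℝ) : Prop :=
  (∀ e ∈ E, 0 ≤ θ e ∧ θ e ≤ 2) ∧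
  (∀ F : Finset (Sym2 V), (F : Set (Sym2 V)) ⊆ E → 0 ≤ Delta θ F) ∧
  (∀ hE : E.Finite, Delta θ hE.toFinset = 0)

/-- `F ⊖ S`: the union of the connected components of `F` that are vertex-disjoint
from `S`. -/
def elimS (F : Finset (Sym2 V)) (S : Set V) : Finset (Sym2 V) :=
  F.filter fun e =>
    ∀ v ∈ e, ∀ s ∈ S, ¬ (SimpleGraph.fromEdgeSet (F : Set (Sym2 V))).Reachable v s

/-- The graph with edge set `F` is connected. -/
def ConnE (F : Finset (Sym2 V)) : Prop :=
  ∀ u ∈ vset F, ∀ w ∈ vset F, (SimpleGraph.fromEdgeSet (F : Set (Sym2 V))).Reachable u w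

/-- The subgraph of `F` induced on a vertex set `T`. -/
def induced (F : Finset (Sym2 V)) (T : Set V) : Finset (Sym2 V) :=
  F.filter fun e => ∀ v ∈ e, v ∈ T

lemma vset_finite (F : Finset (Sym2 V)) : (vset F).Finite := by
  have h : vset F = ⋃ e ∈ F, {v | v ∈ e} := by
    ext v
    simp [vset]
  rw [h]
  refine F.finite_toSet.biUnion fun e _ => ?_
  induction e with
  | _ a b =>
    refine (Set.toFinite {a, b}).subset fun v hv => ?_
    simpa using hv

/-- Summing a symmetrized weight over edges amounts to summing over ordered pairs of
vertices spanning an edge. -/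
lemma sum_symmetrized_eq {θ : Sym2 V → ℝ} {M : V → V → ℝ}
    (hθ : ∀ v w : V, θ s(v, w) = M v w + M w v)
    {F : Finset (Sym2 V)} (hF : ∀ e ∈ F, ¬ e.IsDiag)
    {S : Finset V} (hS : vset F ⊆ S) :
    ∑ e ∈ F, θ e = ∑ v ∈ S, ∑ w ∈ S, if s(v, w) ∈ F then M v w else 0 := by
  rw [← Finset.sum_product' S S fun v w => if s(v, w) ∈ F then M v w else 0,
    ← Finset.sum_filter,
    ← Finset.sum_fiberwise_of_maps_to (g := fun p : V × V => s(p.1, p.2)) (t := F)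
      fun p hp => (Finset.mem_filter.1 hp).2]
  refine Finset.sum_congr rfl fun e he => ?_
  induction e with
  | _ a b =>
    have hab : a ≠ b := by simpa using hF _ he
    have ha : a ∈ S := hS ⟨_, he, Sym2.mem_mk_left a b⟩
    have hb : b ∈ S := hS ⟨_, he, Sym2.mem_mk_right a b⟩
    have hpairs : ((S ×ˢ S).filter fun p => s(p.1, p.2) ∈ F).filter
        (fun p => s(p.1, p.2) = s(a, b)) = {(a, b), (b, a)} := by
      ext ⟨v, w⟩
      simp only [Finset.mem_filter, Finset.mem_product, Finset.mem_insert,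
        Finset.mem_singleton, Prod.mk.injEq, Sym2.eq_iff]
      constructor
      · exact fun h => h.2
      · rintro (⟨rfl, rfl⟩ | ⟨rfl, rfl⟩)
        · exact ⟨⟨⟨ha, hb⟩, he⟩, Or.inl ⟨rfl, rfl⟩⟩
        · exact ⟨⟨⟨hb, ha⟩, Sym2.eq_swap ▸ he⟩, Or.inr ⟨rfl, rfl⟩⟩
    rw [hpairs, Finset.sum_pair (by simp [hab]), hθ]

/-- The excess of a finite edge set under the weighting induced by a Markov chain is the
transition mass leaving along pairs outside the edge set. -/
lemma Delta_eq_finsum {θ : Sym2 V → ℝ} {M : V → V → ℝ}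
    (hfin : ∀ v, (Function.support (M v)).Finite)
    (hrow : ∀ v : V, ∑ᶠ w : V, M v w = 1)
    (hθ : ∀ v w : V, θ s(v, w) = M v w + M w v)
    {F : Finset (Sym2 V)} (hF : ∀ e ∈ F, ¬ e.IsDiag) :
    Delta θ F = ∑ᶠ v ∈ vset F, ∑ᶠ (w : V) (_ : s(v, w) ∉ F), M v w := by
  set S := (vset_finite F).toFinset with hSdef
  have hS : vset F = S := by simp [hSdef]
  have hsplit (v : V) : (1 : ℝ) = (∑ w ∈ S, if s(v, w) ∈ F then M v w else 0) +
      ∑ᶠ (w : V) (_ : s(v, w) ∉ F), M v w := by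
    have hin : (∑ w ∈ S, if s(v, w) ∈ F then M v w else 0) =
        ∑ᶠ w, if s(v, w) ∈ F then M v w else 0 := by
      refine (finsum_eq_sum_of_support_subset _ fun w hw => ?_).symm
      have hwF : s(v, w) ∈ F := by
        by_contra h
        simp [h] at hw
      exact hS ▸ ⟨_, hwF, Sym2.mem_mk_right v w⟩
    simp only [hin, finsum_eq_if]
    rw [← finsum_add_distrib, ← hrow v]
    · refine finsum_congr fun w => ?_
      by_cases h : s(v, w) ∈ F <;> simp [h]
    all_goals
      refine (hfin v).subset fun w hw => ?_
      simp only [Function.mem_support, ne_eq, ite_eq_right_iff, not_forall] at hw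
      exact hw.2
  rw [Delta, sum_symmetrized_eq hθ hF hS.subset, hS, Set.ncard_coe_finset,
    finsum_mem_coe_finset, sub_eq_iff_eq_add', ← Finset.sum_add_distrib,
    ← Finset.sum_congr rfl fun v _ => hsplit v]
  simp

/-- If `M` is a Markov chain on a simple, locally finite graph `G`
without isolated vertices, then `θ({v,w}) := M_{v,w} + M_{w,v}` is a threshold
weighting on `G`, and for every finite subgraph `F ⊆ G`,
`Δ_θ(F) = Σ_{v ∈ V(F)} Σ_{w ∈ V(G), {v,w} ∉ E(F)} M_{v,w}`. -/
theorem stmt0 {V : Type*} (G : SimpleGraph V) [∀ v : V, Fintype (G.neighborSet v)]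
    (hNoIso : ∀ v : V, ∃ w : V, G.Adj v w)
    (M : V → V → ℝ)
    (hM0 : ∀ v w : V, 0 ≤ M v w) (hM1 : ∀ v w : V, M v w ≤ 1)
    (hrow : ∀ v : V, ∑ᶠ w : V, M v w = 1)
    (hsupp : ∀ v w : V, 0 < M v w → G.Adj v w)
    (θ : Sym2 V → ℝ) (hθ : ∀ v w : V, θ s(v, w) = M v w + M w v) :
    IsThresholdWeighting G.edgeSet θ ∧
    ∀ F : Finset (Sym2 V), (F : Set (Sym2 V)) ⊆ G.edgeSet →
      Delta θ F = ∑ᶠ v ∈ vset F, ∑ᶠ (w : V) (_ : s(v, w) ∉ F), M v w := by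
  have hzero (v w : V) (h : ¬ G.Adj v w) : M v w = 0 :=
    le_antisymm (not_lt.1 fun hlt => h (hsupp v w hlt)) (hM0 v w)
  have hfin (v : V) : (Function.support (M v)).Finite :=
    (Set.toFinite (G.neighborSet v)).subset fun w hw => by
      by_contra h
      exact hw (hzero v w h)
  have hDelta (F : Finset (Sym2 V)) (hF : (F : Set (Sym2 V)) ⊆ G.edgeSet) :=
    Delta_eq_finsum hfin hrow hθ (F := F) fun e he => G.not_isDiag_of_mem_edgeSet (hF he)
  refine ⟨⟨fun e _ => ?_, fun F hF => ?_, fun hE => ?_⟩, hDelta⟩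
  · induction e with
    | _ a b =>
      rw [hθ]
      constructor <;> linarith [hM0 a b, hM0 b a, hM1 a b, hM1 b a]
  · rw [hDelta F hF]
    exact finsum_nonneg fun v => finsum_nonneg fun _ => finsum_nonneg fun w =>
      finsum_nonneg fun _ => hM0 v w
  · rw [hDelta _ (by simp)]
    refine finsum_mem_eq_zero_of_forall_eq_zero fun v _ =>
      finsum_mem_eq_zero_of_forall_eq_zero (s := {w | s(v, w) ∉ hE.toFinset}) fun w hw =>
        hzero v w ?_
    simpa using hw

end Paper

end
end

section
/- Suppose (G,θ) and (G*,θ*) are threshold-weighted graphs such that G is a finite subgraph of G* and θ*(e) ≤ θ(e) for all e ∈ E(G). Then for any join-tree A with graph G (regarded also as a join-tree over G*), Φ_θ(A) ≥ Φ_{θ*}(A) − Σ_{e∈E(G)} (θ(e) − θ*(e)), where Φ_θ is the potential function over (G,θ) and Φ_{θ*} is the potential function over (G*,θ*). -/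
open scoped Classical

noncomputable section

namespace Paper

variable {V : Type*}

namespace JoinTree

/-- The graph of a join-tree: the finite subgraph whose edges are the labels
occurring in the tree. -/
def graph : JoinTree V → Finset (Sym2 V)
  | leaf none => ∅
  | leaf (some e) => {e}
  | node B C => graph B ∪ graph C

/-- `Sub D A` means `D ⪯ A`: `D = ⟨⟩`, or `D = A`, or `D` is a sub-join-tree of a
child of `A`. -/
inductive Sub : JoinTree V → JoinTree V → Prop
  | empty (A : JoinTree V) : Sub (leaf none) A
  | refl (A : JoinTree V) : Sub A A
  | left {D B C : JoinTree V} : Sub D B → Sub D (node B C)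
  | right {D B C : JoinTree V} : Sub D C → Sub D (node B C)

/-- `SubP D A` means `D ≺ A`, i.e. `D ⪯ A` and `D ≠ A`. -/
def SubP (D A : JoinTree V) : Prop := Sub D A ∧ D ≠ A

/-- A join-tree is atomic if it is a single (labeled or unlabeled) leaf. -/
def Atomic (A : JoinTree V) : Prop := ∃ l, A = leaf l

/-- Replace every leaf label not belonging to `E'` by `⊥`. -/
def prune : JoinTree V → Finset (Sym2 V) → JoinTree V
  | leaf none, _ => leaf none
  | leaf (some e), E' => if e ∈ E' then leaf (some e) else leaf none
  | node B C, E' => node (prune B E') (prune C E')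

/-- `A ⊖ S`: delete all leaf labels except those belonging to `Gr(A) ⊖ S`. -/
def elimT (A : JoinTree V) (S : Set V) : JoinTree V := prune A (Paper.elimS A.graph S)

/-- `A` is a join-tree over the graph with edge set `E` (all labels come from `E`). -/
def Over (E : Set (Sym2 V)) (A : JoinTree V) : Prop := (A.graph : Set (Sym2 V)) ⊆ E

lemma graph_mono_of_sub {D A : JoinTree V} (h : Sub D A) : D.graph ⊆ A.graph := by
  induction h with
  | empty A => intro e he; simp [graph] at he
  | refl A => exact Finset.Subset.refl _
  | left _ ih => exact ih.trans Finset.subset_union_left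
  | right _ ih => exact ih.trans Finset.subset_union_right

end JoinTree

open JoinTree

/-- The constraints defining the (one-parameter) potential function `Φ_θ` on
join-trees over the graph with edge set `E`: nonnegativity, the atomic base case,
inequality (†) (in both orders of the children) and inequality (‡). -/
def PhiOk (E : Set (Sym2 V)) (θ : Sym2 V → ℝ) (f : JoinTree V → ℝ) : Prop :=
  (∀ A : JoinTree V, Over E A → 0 ≤ f A) ∧
  (∀ A : JoinTree V, Over E A → Atomic A → Delta θ A.graph ≤ f A) ∧
  (∀ B C D : JoinTree V, Over E (JoinTree.node B C) → Sub D B →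
      f D + Delta θ (elimS C.graph (vset D.graph))
          + Delta θ (elimS (JoinTree.node B C).graph (vset C.graph ∪ vset D.graph))
        ≤ f (JoinTree.node B C)) ∧
  (∀ B C D : JoinTree V, Over E (JoinTree.node B C) → Sub D C →
      f D + Delta θ (elimS B.graph (vset D.graph))
          + Delta θ (elimS (JoinTree.node B C).graph (vset B.graph ∪ vset D.graph))
        ≤ f (JoinTree.node B C)) ∧
  (∀ A D E' : JoinTree V, Over E A → SubP D A → SubP E' A →
      (f D + f (elimT E' (vset D.graph)) + Delta θ A.graph
          + Delta θ (elimS A.graph (vset D.graph ∪ vset E'.graph))) / 2 ≤ f A)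

/-- The potential function `Φ_θ(A)`: the pointwise smallest function satisfying
the constraints `PhiOk`. -/
def Phi (E : Set (Sym2 V)) (θ : Sym2 V → ℝ) (A : JoinTree V) : ℝ :=
  sInf { y | ∃ f : JoinTree V → ℝ, PhiOk E θ f ∧ y = f A }

namespace JoinTree

lemma graph_prune_subset (A : JoinTree V) (F : Finset (Sym2 V)) :
    (prune A F).graph ⊆ A.graph ∩ F := by
  induction A with
  | leaf l =>
    cases l with
    | none => simp [prune, graph]
    | some e =>
      by_cases h : e ∈ F <;> simp [prune, graph, h]
  | node B C hB hC =>
    simp only [prune, graph]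
    intro e he
    rcases Finset.mem_union.1 he with h | h
    · have := hB h
      simp_all
    · have := hC h
      simp_all

lemma graph_elimT_subset_elimS (A : JoinTree V) (S : Set V) :
    (elimT A S).graph ⊆ elimS A.graph S :=
  (graph_prune_subset _ _).trans Finset.inter_subset_right

lemma graph_elimT_subset (A : JoinTree V) (S : Set V) : (elimT A S).graph ⊆ A.graph :=
  (graph_prune_subset _ _).trans Finset.inter_subset_left

lemma Over.of_subset {E : Set (Sym2 V)} {A D : JoinTree V} (hA : Over E A)
    (h : D.graph ⊆ A.graph) : Over E D :=
  (Finset.coe_subset.2 h).trans hA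

/-- The number of nodes of a join-tree, not counting unlabeled leaves. -/
def size : JoinTree V → ℕ
  | leaf none => 0
  | leaf (some _) => 1
  | node B C => size B + size C + 1

lemma card_graph_le_size (A : JoinTree V) : A.graph.card ≤ A.size := by
  induction A with
  | leaf l => cases l <;> simp [graph, size]
  | node B C hB hC =>
    have := Finset.card_union_le B.graph C.graph
    simp only [graph, size]
    omega

lemma size_prune_le (A : JoinTree V) (F : Finset (Sym2 V)) : (prune A F).size ≤ A.size := by
  induction A with
  | leaf l =>
    cases l with
    | none => simp [prune]
    | some e => by_cases h : e ∈ F <;> simp [prune, size, h]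
  | node B C hB hC =>
    simp only [prune, size]
    omega

lemma Sub.size_le {D A : JoinTree V} (h : Sub D A) : D.size ≤ A.size := by
  induction h with
  | empty A => simp [size]
  | refl A => rfl
  | left _ ih => simp only [size]; omega
  | right _ ih => simp only [size]; omega

lemma SubP.size_lt {D A : JoinTree V} (h : SubP D A) : D.size < A.size := by
  obtain ⟨h, hne⟩ := h
  cases h with
  | empty A =>
    rcases A with (_ | e) | ⟨B, C⟩
    · exact absurd rfl hne
    · simp [size]
    · simp [size]
  | refl A => exact absurd rfl hne
  | left h => have := h.size_le; simp only [size]; omega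
  | right h => have := h.size_le; simp only [size]; omega

end JoinTree

lemma elimS_subset (F : Finset (Sym2 V)) (S : Set V) : elimS F S ⊆ F :=
  Finset.filter_subset _ _

lemma disjoint_elimS {F F' : Finset (Sym2 V)} {S : Set V} (h : vset F' ⊆ S) :
    Disjoint F' (elimS F S) := by
  rw [Finset.disjoint_left]
  intro e he he'
  have hv : e.out.1 ∈ e := Sym2.out_fst_mem e
  exact (Finset.mem_filter.1 he').2 _ hv _ (h ⟨e, he, hv⟩) (SimpleGraph.Reachable.refl _)

lemma ncard_vset_le (F : Finset (Sym2 V)) : (vset F).ncard ≤ 2 * F.card := by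
  have h : vset F = ↑(F.biUnion fun e => e.toFinset) := by
    ext v
    simp [vset]
  rw [h, Set.ncard_coe_finset, mul_comm]
  refine Finset.card_biUnion_le_card_mul _ _ _ fun e _ => ?_
  by_cases he : e.IsDiag
  · rw [Sym2.card_toFinset_of_isDiag e he]; omega
  · rw [Sym2.card_toFinset_of_not_isDiag e he]

lemma Delta_le_two_mul_card {θ : Sym2 V → ℝ} {F : Finset (Sym2 V)} (h : ∀ e ∈ F, 0 ≤ θ e) :
    Delta θ F ≤ 2 * F.card := by
  have h1 : ((vset F).ncard : ℝ) ≤ 2 * F.card := mod_cast ncard_vset_le F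
  have h2 := Finset.sum_nonneg h
  unfold Delta
  linarith

lemma Delta_eq_add_sum_sub (θ η : Sym2 V → ℝ) (F : Finset (Sym2 V)) :
    Delta η F = Delta θ F + ∑ e ∈ F, (θ e - η e) := by
  simp only [Delta, Finset.sum_sub_distrib]
  ring

/-- The sum of a function over pairwise disjoint subsets is at most the sum over the whole set. -/
lemma sum_add_sum_add_sum_le {ι : Type*} {δ : ι → ℝ} {P Q R T : Finset ι}
    (hδ : ∀ e ∈ T, 0 ≤ δ e) (hP : P ⊆ T) (hQ : Q ⊆ T) (hR : R ⊆ T)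
    (hPQ : Disjoint P Q) (hPR : Disjoint P R) (hQR : Disjoint Q R) :
    ∑ e ∈ P, δ e + ∑ e ∈ Q, δ e + ∑ e ∈ R, δ e ≤ ∑ e ∈ T, δ e := by
  rw [← Finset.sum_union hPQ, ← Finset.sum_union (Finset.disjoint_union_left.2 ⟨hPR, hQR⟩)]
  exact Finset.sum_le_sum_of_subset_of_nonneg
    (Finset.union_subset (Finset.union_subset hP hQ) hR) fun e he _ => hδ e he

lemma phiOk_size_sq {E : Set (Sym2 V)} {θ : Sym2 V → ℝ} (hθ : ∀ e ∈ E, 0 ≤ θ e) :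
    PhiOk E θ fun A => 4 * (A.size : ℝ) ^ 2 := by
  have hΔ : ∀ (A : JoinTree V) (F : Finset (Sym2 V)), Over E A → F ⊆ A.graph →
      Delta θ F ≤ 2 * A.size := by
    intro A F hA hF
    have h1 := Delta_le_two_mul_card (θ := θ) (F := F) fun e he => hθ e (hA (hF he))
    have h2 : (F.card : ℝ) ≤ A.size :=
      mod_cast (Finset.card_le_card hF).trans A.card_graph_le_size
    linarith
  have hstep : ∀ {m n : ℕ}, m < n → (m : ℝ) ^ 2 + n ≤ (n : ℝ) ^ 2 := by
    intro m n h
    have : m ^ 2 + n ≤ n ^ 2 := by nlinarith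
    exact_mod_cast this
  refine ⟨fun A _ => by positivity, fun A hA _ => ?_, fun B C D hA hD => ?_,
    fun B C D hA hD => ?_, fun A D E' hA hD hE' => ?_⟩
  · have h1 := hΔ A _ hA subset_rfl
    have h2 : (A.size : ℝ) ≤ (A.size : ℝ) ^ 2 := mod_cast Nat.le_self_pow two_ne_zero _
    nlinarith
  · have h1 := hΔ _ _ hA ((elimS_subset C.graph (vset D.graph)).trans Finset.subset_union_right)
    have h2 := hΔ _ _ hA (elimS_subset (node B C).graph (vset C.graph ∪ vset D.graph))
    have h3 := hstep (show D.size < (node B C).size by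
      have := hD.size_le; simp only [size]; omega)
    linarith
  · have h1 := hΔ _ _ hA ((elimS_subset B.graph (vset D.graph)).trans Finset.subset_union_left)
    have h2 := hΔ _ _ hA (elimS_subset (node B C).graph (vset B.graph ∪ vset D.graph))
    have h3 := hstep (show D.size < (node B C).size by
      have := hD.size_le; simp only [size]; omega)
    linarith
  · have h1 := hΔ _ _ hA subset_rfl
    have h2 := hΔ _ _ hA (elimS_subset A.graph (vset D.graph ∪ vset E'.graph))
    have h3 := hstep hD.size_lt
    have h4 := hstep ((size_prune_le E' (elimS E'.graph (vset D.graph))).trans_lt hE'.size_lt)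
    have h5 : (0 : ℝ) ≤ A.size := by positivity
    unfold elimT
    linarith

/-- Feasibility passes to a smaller weighting after adding the total weight difference. -/
lemma PhiOk.add_sum {E : Set (Sym2 V)} {θ η : Sym2 V → ℝ} {f : JoinTree V → ℝ}
    (hf : PhiOk E θ f) (hle : ∀ e ∈ E, η e ≤ θ e) :
    PhiOk E η fun A => f A + ∑ e ∈ A.graph, (θ e - η e) := by
  obtain ⟨h0, ha, hl, hr, hd⟩ := hf
  have hδ : ∀ A : JoinTree V, Over E A → ∀ e ∈ A.graph, 0 ≤ θ e - η e :=
    fun A hA e he => sub_nonneg.2 (hle e (hA he))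
  refine ⟨fun A hA => add_nonneg (h0 A hA) (Finset.sum_nonneg (hδ A hA)), fun A hA hat => ?_,
    fun B C D hA hD => ?_, fun B C D hA hD => ?_, fun A D E' hA hD hE' => ?_⟩
  · rw [Delta_eq_add_sum_sub θ]
    linarith [ha A hA hat]
  · have := hl B C D hA hD
    have := sum_add_sum_add_sum_le (hδ _ hA)
      ((graph_mono_of_sub hD).trans Finset.subset_union_left)
      ((elimS_subset C.graph (vset D.graph)).trans Finset.subset_union_right)
      (elimS_subset (node B C).graph (vset C.graph ∪ vset D.graph))
      (disjoint_elimS subset_rfl) (disjoint_elimS Set.subset_union_right)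
      (disjoint_elimS ((vset_mono (elimS_subset _ _)).trans Set.subset_union_left))
    rw [Delta_eq_add_sum_sub θ, Delta_eq_add_sum_sub θ η (elimS (node B C).graph _)]
    linarith
  · have := hr B C D hA hD
    have := sum_add_sum_add_sum_le (hδ _ hA)
      ((graph_mono_of_sub hD).trans Finset.subset_union_right)
      ((elimS_subset B.graph (vset D.graph)).trans Finset.subset_union_left)
      (elimS_subset (node B C).graph (vset B.graph ∪ vset D.graph))
      (disjoint_elimS subset_rfl) (disjoint_elimS Set.subset_union_right)
      (disjoint_elimS ((vset_mono (elimS_subset _ _)).trans Set.subset_union_left))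
    rw [Delta_eq_add_sum_sub θ, Delta_eq_add_sum_sub θ η (elimS (node B C).graph _)]
    linarith
  · have := hd A D E' hA hD hE'
    have := sum_add_sum_add_sum_le (hδ _ hA) (graph_mono_of_sub hD.1)
      ((graph_elimT_subset E' (vset D.graph)).trans (graph_mono_of_sub hE'.1))
      (elimS_subset A.graph (vset D.graph ∪ vset E'.graph))
      ((disjoint_elimS subset_rfl).mono_right (graph_elimT_subset_elimS _ _))
      (disjoint_elimS Set.subset_union_left)
      (disjoint_elimS ((vset_mono (graph_elimT_subset _ _)).trans Set.subset_union_right))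
    rw [Delta_eq_add_sum_sub θ η A.graph, Delta_eq_add_sum_sub θ η (elimS A.graph _)]
    linarith

/-- Replacing a feasible function by a minimum on the join-trees over a subgraph
preserves feasibility. -/
lemma PhiOk.min_on {E E₀ : Set (Sym2 V)} {θ : Sym2 V → ℝ} {f g : JoinTree V → ℝ}
    (hf : PhiOk E₀ θ f) (hg : PhiOk E θ g) :
    PhiOk E θ fun A => if Over E₀ A then min (f A) (g A) else g A := by
  set k : JoinTree V → ℝ := fun A => if Over E₀ A then min (f A) (g A) else g A with hk
  have hkg : ∀ A, k A ≤ g A := by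
    intro A
    by_cases h : Over E₀ A <;> simp [hk, h]
  have hkf : ∀ A, Over E₀ A → k A ≤ f A := by
    intro A h
    simp [hk, h]
  have le_k : ∀ {A x}, (Over E₀ A → x ≤ f A) → x ≤ g A → x ≤ k A := by
    intro A x h1 h2
    by_cases h : Over E₀ A
    · simp [hk, h, h1 h, h2]
    · simp [hk, h, h2]
  obtain ⟨f0, fa, fl, fr, fd⟩ := hf
  obtain ⟨g0, ga, gl, gr, gd⟩ := hg
  refine ⟨fun A hA => le_k (f0 A) (g0 A hA),
    fun A hA hat => le_k (fun h => fa A h hat) (ga A hA hat),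
    fun B C D hA hD => le_k (fun h => ?_) ?_, fun B C D hA hD => le_k (fun h => ?_) ?_,
    fun A D E' hA hD hE' => le_k (fun h => ?_) ?_⟩
  · linarith [fl B C D h hD, hkf D (h.of_subset (graph_mono_of_sub (.left hD)))]
  · linarith [gl B C D hA hD, hkg D]
  · linarith [fr B C D h hD, hkf D (h.of_subset (graph_mono_of_sub (.right hD)))]
  · linarith [gr B C D hA hD, hkg D]
  · linarith [fd A D E' h hD hE', hkf D (h.of_subset (graph_mono_of_sub hD.1)),
      hkf (elimT E' (vset D.graph))
        (h.of_subset ((graph_elimT_subset _ _).trans (graph_mono_of_sub hE'.1)))]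
  · linarith [gd A D E' hA hD hE', hkg D, hkg (elimT E' (vset D.graph))]

lemma Phi_le {E : Set (Sym2 V)} {θ : Sym2 V → ℝ} {f : JoinTree V → ℝ} (hf : PhiOk E θ f)
    {A : JoinTree V} (hA : Over E A) : Phi E θ A ≤ f A := by
  refine csInf_le ⟨0, ?_⟩ ⟨f, hf, rfl⟩
  rintro _ ⟨g, hg, rfl⟩
  exact hg.1 A hA

/-- If `(G,θ)` and `(G*,θ*)` are threshold-weighted graphs with `G`
a finite subgraph of `G*` and `θ* ≤ θ` on `E(G)`, then for every join-tree `A` with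
graph `G`, `Φ_θ(A) ≥ Φ_{θ*}(A) − Σ_{e ∈ E(G)} (θ(e) − θ*(e))`. -/
theorem stmt1 {V : Type*} (Estar : Set (Sym2 V)) (G : Finset (Sym2 V))
    (hGE : (G : Set (Sym2 V)) ⊆ Estar)
    (θ θstar : Sym2 V → ℝ)
    (hθ : IsThresholdWeighting (G : Set (Sym2 V)) θ)
    (hθstar : IsThresholdWeighting Estar θstar)
    (hle : ∀ e ∈ G, θstar e ≤ θ e)
    (A : JoinTree V) (hA : A.graph = G) :
    Phi Estar θstar A - ∑ e ∈ G, (θ e - θstar e) ≤ Phi (G : Set (Sym2 V)) θ A := by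
  refine le_csInf ⟨_, _, phiOk_size_sq fun e he => (hθ.1 e he).1, rfl⟩ ?_
  rintro _ ⟨f, hf, rfl⟩
  have hG : Over (G : Set (Sym2 V)) A := by rw [Over, hA]
  have h := Phi_le ((hf.add_sum hle).min_on (phiOk_size_sq fun e he => (hθstar.1 e he).1))
    (show Over Estar A from hG.trans hGE)
  simp only [if_pos hG, hA] at h
  linarith [h.trans (min_le_left _ _)]

end Paper

end
end

section
/- Let H be a finite connected subgraph of T_∞ and let y ∈ V(H) be such that E(H) ∩ E(T_y) ≠ ∅ and H does not contain any path from y to a leaf of T_y (a vertex of V_0 ∩ V(T_y)). Then ∂(H) ≥ (|E(H) ∩ E(T_y)| + 1)/2. -/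
open scoped Classical

noncomputable section

namespace Paper

variable {V : Type*}

/-- Vertices of the infinite rootless layered binary tree `T_∞`: `(j, m)` is the
`m`-th vertex of level `j` (level `0` is the leaf level). -/
abbrev Vtx : Type := ℕ × ℕ

/-- The parent of a vertex of `T_∞`. -/
def parentV (v : Vtx) : Vtx := (v.1 + 1, v.2 / 2)

/-- The edge set of `T_∞`: each vertex is joined to its parent. -/
def ETinf : Set (Sym2 Vtx) := { e | ∃ v : Vtx, e = s(v, parentV v) }

/-- `Desc v x`: `v` is a vertex of the complete binary tree `T_x` rooted at `x`
(i.e. a descendant of `x`, including `x` itself). -/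
def Desc (v x : Vtx) : Prop := v.1 ≤ x.1 ∧ v.2 / 2 ^ (x.1 - v.1) = x.2

/-- The edge set of the complete binary tree `T_x` rooted at `x` inside `T_∞`. -/
def TxE (x : Vtx) : Set (Sym2 Vtx) :=
  { e | ∃ v : Vtx, Desc v x ∧ v ≠ x ∧ e = s(v, parentV v) }

/-- The edge set of `T_x^+`: `T_x` together with the edge from `x` to its parent. -/
def TxPlusE (x : Vtx) : Set (Sym2 Vtx) := TxE x ∪ {s(x, parentV x)}

/-- `T_x ⊆ F` as subgraphs of `T_∞` (for `x` of level `0`, `T_x` is the single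
vertex `x`, and containment means `x ∈ V(F)`). -/
def TxCont (x : Vtx) (F : Finset (Sym2 Vtx)) : Prop :=
  TxE x ⊆ (F : Set (Sym2 Vtx)) ∧ (x.1 = 0 → x ∈ vset F)

/-- The max-complete height `λ(F)`: the largest `k` such that `T_x ⊆ F` for some
vertex `x` of level `k` (and `0` if there is no such `x`). -/
def lam (F : Finset (Sym2 Vtx)) : ℕ := sSup { k | ∃ x : Vtx, x.1 = k ∧ TxCont x F }

/-- The boundary size `∂(F) = |V(F) ∩ V(T_∞ \ F)|`. -/
def bdry (F : Finset (Sym2 Vtx)) : ℕ :=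
  (vset F ∩ {v | ∃ e ∈ ETinf, e ∉ F ∧ v ∈ e}).ncard

/-- The threshold weighting on `T_∞` induced by the uniform random walk:
`2/3` on edges containing a leaf, `4/3` otherwise. -/
def thetaT : Sym2 Vtx → ℝ := fun e => if ∃ v ∈ e, v.1 = 0 then 2 / 3 else 4 / 3

/-- The two children of a vertex of positive level: `b = 0` on the left, `b = 1` on the right. -/
def childV (v : Vtx) (b : ℕ) : Vtx := (v.1 - 1, 2 * v.2 + b)

lemma parentV_childV {v : Vtx} {b : ℕ} (hv : v.1 ≠ 0) (hb : b < 2) :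
    parentV (childV v b) = v := by
  ext <;> simp only [parentV, childV] <;> omega

lemma childV_ne {v y : Vtx} (b : ℕ) (hv : v.1 ≠ 0) (h : Desc v y) : childV v b ≠ y := by
  rintro rfl
  have := h.1
  simp only [childV] at this
  omega

lemma Desc.childV {v y : Vtx} {b : ℕ} (hv : v.1 ≠ 0) (hb : b < 2) (h : Desc v y) :
    Desc (childV v b) y := by
  obtain ⟨h1, h2⟩ := h
  refine ⟨by simp only [Paper.childV]; omega, ?_⟩
  have e : y.1 - (v.1 - 1) = (y.1 - v.1) + 1 := by omega
  simp only [Paper.childV]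
  rw [e, pow_succ', ← Nat.div_div_eq_div_mul, ← h2]
  congr 1
  omega

lemma childV_injective {v w : Vtx} {b c : ℕ} (hv : v.1 ≠ 0) (hw : w.1 ≠ 0) (hb : b < 2)
    (hc : c < 2) (h : childV v b = childV w c) : v = w ∧ b = c := by
  have hvw : v = w := by rw [← parentV_childV hv hb, h, parentV_childV hw hc]
  subst hvw
  simp only [childV, Prod.mk.injEq] at h
  exact ⟨rfl, by omega⟩

/-- If `H` is a finite connected subgraph of `T_∞`, `y ∈ V(H)`,
`E(H) ∩ E(T_y) ≠ ∅` and `H` contains no path from `y` to a leaf of `T_y`, then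
`∂(H) ≥ (|E(H) ∩ E(T_y)| + 1)/2`. -/
theorem stmt4 (H : Finset (Sym2 Vtx)) (hH : (H : Set (Sym2 Vtx)) ⊆ ETinf)
    (hconn : ConnE H) (y : Vtx) (hy : y ∈ vset H)
    (hmeet : ∃ e ∈ H, e ∈ TxE y)
    (hnopath : ¬ ∃ l : Vtx, l.1 = 0 ∧ Desc l y ∧
        (SimpleGraph.fromEdgeSet (H : Set (Sym2 Vtx))).Reachable y l) :
    (((H.filter (· ∈ TxE y)).card : ℝ) + 1) / 2 ≤ (bdry H : ℝ) := by
  set P : Finset Vtx := (vset_finite H).toFinset.filter (Desc · y)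
  set S : Finset Vtx := P.filter fun v => v ≠ y ∧ s(v, parentV v) ∈ H
  set B : Set Vtx := {v | ∃ e ∈ ETinf, e ∉ H ∧ v ∈ e}
  have hP : ∀ v, v ∈ P ↔ v ∈ vset H ∧ Desc v y := by simp [P]
  have hpos : ∀ v ∈ P, v.1 ≠ 0 := fun v hv h0 =>
    hnopath ⟨v, h0, ((hP v).1 hv).2, hconn y hy v ((hP v).1 hv).1⟩
  have hyP : y ∈ P := (hP y).2 ⟨hy, le_rfl, by simp⟩
  have hES : (H.filter (· ∈ TxE y)).card ≤ S.card := by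
    refine (Finset.card_le_card fun e he => ?_).trans
      (Finset.card_image_le (s := S) (f := fun v => s(v, parentV v)))
    obtain ⟨heH, v, hv, hvy, rfl⟩ := Finset.mem_filter.1 he
    exact Finset.mem_image.2 ⟨v, Finset.mem_filter.2
      ⟨(hP v).2 ⟨⟨_, heH, Sym2.mem_mk_left _ _⟩, hv⟩, hvy, heH⟩, rfl⟩
  have hSP : S.card + 1 ≤ P.card :=
    Finset.card_lt_card (Finset.filter_ssubset.2 ⟨y, hyP, by simp⟩)
  have hNS : (P.filter (· ∉ B)).card * 2 ≤ S.card := by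
    rw [← Finset.card_range 2, ← Finset.card_product]
    refine Finset.card_le_card_of_injOn (fun p => childV p.1 p.2) ?_ ?_
    · rintro ⟨v, b⟩ hp
      simp only [Finset.coe_product, Set.mem_prod, Finset.mem_coe, Finset.mem_filter,
        Finset.mem_range] at hp
      obtain ⟨⟨hv, hvB⟩, hb⟩ := hp
      have hpar := parentV_childV (hpos v hv) hb
      have hvy := ((hP v).1 hv).2
      have hedge : s(childV v b, parentV (childV v b)) ∈ H := by
        by_contra hn
        exact hvB ⟨_, ⟨_, rfl⟩, hn, by rw [hpar]; exact Sym2.mem_mk_right _ _⟩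
      exact Finset.mem_filter.2 ⟨(hP _).2 ⟨⟨_, hedge, Sym2.mem_mk_left _ _⟩,
        hvy.childV (hpos v hv) hb⟩, childV_ne b (hpos v hv) hvy, hedge⟩
    · rintro ⟨v, b⟩ hp ⟨w, c⟩ hq h
      simp only [Finset.coe_product, Set.mem_prod, Finset.mem_coe, Finset.mem_filter,
        Finset.mem_range] at hp hq
      obtain ⟨rfl, rfl⟩ :=
        childV_injective (hpos v hp.1.1) (hpos w hq.1.1) hp.2 hq.2 h
      rfl
  have hB : (P.filter (· ∈ B)).card ≤ bdry H := by
    rw [← Set.ncard_coe_finset]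
    refine Set.ncard_le_ncard (fun v hv => ?_) ((vset_finite H).inter_of_left _)
    obtain ⟨hv, hvB⟩ := Finset.mem_filter.1 (Finset.mem_coe.1 hv)
    exact ⟨((hP v).1 hv).1, hvB⟩
  have hsplit := Finset.card_filter_add_card_filter_not (s := P) (· ∈ B)
  have hfin : (H.filter (· ∈ TxE y)).card + 1 ≤ 2 * bdry H := by omega
  rw [div_le_iff₀ two_pos, mul_comm]
  exact_mod_cast hfin

end Paper

end
end

section
/- Let k ≥ 1, let x ∈ V_k, and suppose G is a subgraph of T_x such that |E(G)| ≤ 2^k − 1 and ∂(G) ≤ k/6. Then there exists a vertex z ∈ V_{k − ∂(G)}(T_x) such that E(G) ∩ E(T_z^+) = ∅. -/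
open scoped Classical

noncomputable section

namespace Paper

variable {V : Type*}

lemma finite_vset {V : Type*} (F : Finset (Sym2 V)) : (vset F).Finite := by
  refine (F.biUnion Sym2.toFinset).finite_toSet.subset ?_
  rintro v ⟨e, he, hv⟩
  simpa using ⟨e, he, hv⟩

lemma Desc.refl (x : Vtx) : Desc x x := by simp [Desc]

lemma Desc.parentV {v z : Vtx} (h : Desc v z) (hne : v ≠ z) : Desc (parentV v) z := by
  obtain ⟨h₁, h₂⟩ := h
  have hlt : v.1 < z.1 := by
    refine lt_of_le_of_ne h₁ fun heq => hne (Prod.ext heq ?_)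
    simpa [heq] using h₂
  refine ⟨hlt, ?_⟩
  simp only [Paper.parentV]
  rw [Nat.div_div_eq_div_mul, ← pow_succ', ← h₂]
  congr 2
  omega

lemma mem_TxPlusE {z : Vtx} {e : Sym2 Vtx} :
    e ∈ TxPlusE z ↔ ∃ v, Desc v z ∧ e = s(v, parentV v) := by
  constructor
  · rintro (⟨v, hv, -, rfl⟩ | rfl)
    · exact ⟨v, hv, rfl⟩
    · exact ⟨z, Desc.refl z, rfl⟩
  · rintro ⟨v, hv, rfl⟩
    by_cases h : v = z
    · exact Or.inr (by simp [h])
    · exact Or.inl ⟨v, hv, h, rfl⟩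

lemma parent_edge_injective : Function.Injective fun v : Vtx => s(v, parentV v) := by
  intro v w h
  rcases Sym2.eq_iff.1 h with h | h
  · exact h.1
  · have h₁ := congrArg Prod.fst h.1
    have h₂ := congrArg Prod.fst h.2
    simp only [parentV] at h₁ h₂
    omega

/-- The boundary vertices of a finite subgraph of `T_∞`. -/
def bdrySet (F : Finset (Sym2 Vtx)) : Set Vtx :=
  vset F ∩ {v | ∃ e ∈ ETinf, e ∉ F ∧ v ∈ e}

lemma finite_bdrySet (F : Finset (Sym2 Vtx)) : (bdrySet F).Finite :=
  (finite_vset F).subset Set.inter_subset_left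

/-- If no vertex of `T_z` is a boundary vertex of `F`, then the edges below `z` lie in `F`
exactly when the edge above `z` does. -/
lemma parent_edge_mem_iff {F : Finset (Sym2 Vtx)} {z : Vtx}
    (hF : ∀ w ∈ bdrySet F, ¬ Desc w z) {v : Vtx} (hv : Desc v z) :
    s(v, parentV v) ∈ F ↔ s(z, parentV z) ∈ F := by
  induction hn : z.1 - v.1 generalizing v with
  | zero =>
    have heq : v.1 = z.1 := le_antisymm hv.1 (by omega)
    have : v = z := Prod.ext heq (by simpa [heq] using hv.2)
    rw [this]
  | succ n ih =>
    have hne : v ≠ z := by rintro rfl; simp at hn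
    have hp := hv.parentV hne
    rw [← ih hp (by simp only [parentV]; omega)]
    constructor
    · intro h
      by_contra h'
      exact hF (parentV v) ⟨⟨_, h, by simp⟩, _, ⟨_, rfl⟩, h', by simp⟩ hp
    · intro h
      by_contra h'
      exact hF (parentV v) ⟨⟨_, h, by simp⟩, _, ⟨_, rfl⟩, h', by simp⟩ hp

lemma exists_mem_bdrySet_ge {F : Finset (Sym2 Vtx)} {v : Vtx} (hv : v ∈ vset F) :
    ∃ w ∈ bdrySet F, v.1 ≤ w.1 := by
  obtain ⟨w, hw, hmax⟩ := (finite_vset F).toFinset.exists_max_image Prod.fst ⟨v, by simpa⟩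
  simp only [Set.Finite.mem_toFinset] at hw hmax
  refine ⟨w, ⟨hw, s(w, parentV w), ⟨w, rfl⟩, fun h => ?_, by simp⟩, hmax v hv⟩
  have := hmax (parentV w) ⟨_, h, by simp⟩
  simp only [parentV] at this
  omega

/-- The graph `T_z^+` with `z` of level `m` has `2 ^ (m + 1) - 1` edges, and these graphs are
edge-disjoint for distinct `z` of the same level. -/
lemma card_mul_le_of_TxPlusE_subset {F : Finset (Sym2 Vtx)} (m : ℕ) (S : Finset ℕ)
    (hS : ∀ a ∈ S, TxPlusE (m, a) ⊆ (F : Set (Sym2 Vtx))) :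
    S.card * (2 ^ (m + 1) - 1) ≤ F.card := by
  have hcard : ((Finset.range (m + 1)).sigma fun t => S ×ˢ Finset.range (2 ^ t)).card =
      S.card * (2 ^ (m + 1) - 1) := by
    have hgeom := Nat.geomSum_eq le_rfl (m + 1)
    rw [Nat.add_one_sub_one, Nat.div_one] at hgeom
    simp [Finset.card_sigma, ← hgeom, Finset.mul_sum]
  rw [← hcard]
  refine Finset.card_le_card_of_injOn
    (fun p => s(((m - p.1, p.2.1 * 2 ^ p.1 + p.2.2) : Vtx),
      parentV (m - p.1, p.2.1 * 2 ^ p.1 + p.2.2))) ?_ ?_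
  · rintro ⟨t, a, l⟩ hp
    simp only [Finset.coe_sigma, Set.mem_sigma_iff, Finset.mem_coe, Finset.mem_range,
      Finset.mem_product] at hp
    obtain ⟨ht, ha, hl⟩ := hp
    refine hS a ha (mem_TxPlusE.2 ⟨_, ⟨Nat.sub_le _ _, ?_⟩, rfl⟩)
    have : m - (m - t) = t := by omega
    simp only [this]
    rw [mul_comm, Nat.mul_add_div (by positivity), Nat.div_eq_of_lt hl, add_zero]
  · rintro ⟨t, a, l⟩ hp ⟨t', a', l'⟩ hp' h
    simp only [Finset.coe_sigma, Set.mem_sigma_iff, Finset.mem_coe, Finset.mem_range,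
      Finset.mem_product] at hp hp'
    obtain ⟨ht, ha, hl⟩ := hp
    obtain ⟨ht', ha', hl'⟩ := hp'
    have h' := Prod.ext_iff.1 (parent_edge_injective h)
    simp only at h'
    obtain rfl : t = t' := by omega
    have h₂ := h'.2
    obtain rfl : a = a' := by
      have := congrArg (· / 2 ^ t) h₂
      simpa [mul_comm _ (2 ^ t), Nat.mul_add_div, Nat.div_eq_of_lt hl, Nat.div_eq_of_lt hl']
        using this
    obtain rfl : l = l' := by omega
    rfl

lemma mul_two_pow_sub_one_gt {b m c : ℕ} (hb : 1 ≤ b) (hbm : b ≤ m + 1)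
    (hc : 2 ^ b + 1 ≤ c + b) : 2 ^ (m + b) - 1 < c * (2 ^ (m + 1) - 1) := by
  obtain ⟨d, rfl⟩ : ∃ d, b = d + 1 := ⟨b - 1, by omega⟩
  have hd : d < 2 ^ d := Nat.lt_two_pow_self
  have hlt : 2 ^ d < 2 ^ (m + 1) := Nat.pow_lt_pow_right (by norm_num) (by omega)
  have hc' : 2 ^ d + 1 ≤ c := by rw [pow_succ] at hc; omega
  have hpow : 2 ^ (m + (d + 1)) = 2 ^ d * 2 ^ (m + 1) := by rw [← pow_add]; congr 1; omega
  refine lt_of_lt_of_le ?_ (Nat.mul_le_mul_right _ hc')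
  rw [hpow]
  generalize 2 ^ d = A at *
  obtain ⟨P, hP⟩ : ∃ P, 2 ^ (m + 1) = P + 1 := ⟨2 ^ (m + 1) - 1, by omega⟩
  rw [hP] at hlt ⊢
  have : (A + 1) * (P + 1 - 1) = A * P + P := by simp; ring
  rw [this, mul_add, mul_one]
  omega

/-- Let `k ≥ 1`, `x ∈ V_k`, and `G ⊆ T_x` with `|E(G)| ≤ 2^k − 1`
and `∂(G) ≤ k/6`. Then there is `z ∈ V_{k − ∂(G)}(T_x)` with
`E(G) ∩ E(T_z^+) = ∅`. -/
theorem stmt6 (k : ℕ) (hk : 1 ≤ k) (x : Vtx) (hx : x.1 = k)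
    (G : Finset (Sym2 Vtx)) (hG : (G : Set (Sym2 Vtx)) ⊆ TxE x)
    (hcard : G.card ≤ 2 ^ k - 1) (hbd : (bdry G : ℝ) ≤ (k : ℝ) / 6) :
    ∃ z : Vtx, z.1 = k - bdry G ∧ Desc z x ∧ ∀ e ∈ G, e ∉ TxPlusE z := by
  have hbk : 6 * bdry G ≤ k := by
    have : (6 * bdry G : ℝ) ≤ k := by linarith
    exact_mod_cast this
  obtain ⟨k', y⟩ := x
  obtain rfl : k' = k := hx
  have hbB : bdry G = (finite_bdrySet G).toFinset.card :=
    Set.ncard_eq_toFinset_card (bdrySet G) (finite_bdrySet G)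
  set B := (finite_bdrySet G).toFinset with hB
  set b := bdry G
  obtain ⟨m, rfl⟩ : ∃ m, k' = m + b := ⟨k' - b, by omega⟩
  rw [Nat.add_sub_cancel]
  by_contra! hcon
  set A := Finset.Ico (y * 2 ^ b) (y * 2 ^ b + 2 ^ b) with hA
  have hAcard : A.card = 2 ^ b := by simp [hA]
  have hmeet : ∀ a ∈ A, ∃ e ∈ G, e ∈ TxPlusE (m, a) := by
    intro a ha
    rw [hA, Finset.mem_Ico] at ha
    refine hcon (m, a) rfl ⟨Nat.le_add_right _ _, ?_⟩
    simp only [Nat.add_sub_cancel_left]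
    exact Nat.div_eq_of_lt_le ha.1 (by rw [add_mul, one_mul]; exact ha.2)
  set S := A.filter fun a => TxPlusE (m, a) ⊆ (G : Set (Sym2 Vtx))
  set R := A.filter fun a => ¬ TxPlusE (m, a) ⊆ (G : Set (Sym2 Vtx))
  have hSR : S.card + R.card = 2 ^ b := by
    rw [← hAcard]; exact Finset.card_filter_add_card_filter_not _
  have hR : ∀ a ∈ R, ∃ w ∈ B, Desc w (m, a) := by
    intro a ha
    obtain ⟨haA, hnot⟩ := Finset.mem_filter.1 ha
    by_contra! hno
    have hno' : ∀ w ∈ bdrySet G, ¬ Desc w (m, a) := fun w hw => hno w (by simpa [hB] using hw)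
    obtain ⟨e, heG, he⟩ := hmeet a haA
    obtain ⟨v, hv, rfl⟩ := mem_TxPlusE.1 he
    refine hnot fun e' he' => ?_
    obtain ⟨v', hv', rfl⟩ := mem_TxPlusE.1 he'
    exact (parent_edge_mem_iff hno' hv').2 ((parent_edge_mem_iff hno' hv).1 heG)
  choose! f hfB hfD using hR
  have hRB : R.card ≤ (B.filter fun w => w.1 ≤ m).card := by
    refine Finset.card_le_card_of_injOn f
      (fun a ha => Finset.mem_filter.2 ⟨hfB a ha, (hfD a ha).1⟩) fun a ha a' ha' h => ?_
    have h₁ := (hfD a ha).2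
    have h₂ := (hfD a' ha').2
    rw [← h] at h₂
    exact h₁.symm.trans h₂
  have hlt : b < 2 ^ b := Nat.lt_two_pow_self
  have hRb : R.card ≤ b := hbB ▸ hRB.trans (Finset.card_filter_le _ _)
  obtain ⟨a, ha⟩ : S.Nonempty := Finset.card_pos.1 (by omega)
  have htop : s(((m, a) : Vtx), parentV (m, a)) ∈ G :=
    (Finset.mem_filter.1 ha).2 (Or.inr rfl)
  obtain ⟨w, hw, hwm⟩ := exists_mem_bdrySet_ge (v := parentV (m, a)) ⟨_, htop, by simp⟩
  have hRlt : R.card < b := by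
    rw [hbB]
    refine hRB.trans_lt (Finset.card_lt_card (Finset.filter_ssubset.2 ⟨w, by simpa [hB], ?_⟩))
    simp only [parentV] at hwm
    omega
  have hle := card_mul_le_of_TxPlusE_subset m S fun a ha => (Finset.mem_filter.1 ha).2
  have hgt := mul_two_pow_sub_one_gt (b := b) (m := m) (c := S.card)
    (by omega) (by omega) (by omega)
  omega

end Paper

end
end

section
/- Let k ≥ 2 and let θ' be the threshold weighting on the complete binary tree T_k of height k arising from the uniform random walk on T_k: θ'(e) = 4/3 if e contains a leaf, θ'(e) = 5/6 if e contains the root, and θ'(e) = 2/3 otherwise. Then for every join-tree A over T_k whose graph equals T_k, Φ_{θ'}(A) ≥ k/30 − 1/5. -/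
open scoped Classical

noncomputable section

namespace Paper

variable {V : Type*}

open JoinTree

/-- The edge set of the complete binary tree `T_x` rooted at `x`, as a `Finset`. -/
def TxFinset (x : Vtx) : Finset (Sym2 Vtx) :=
  (Finset.range x.1).biUnion fun j =>
    (Finset.Ico (x.2 * 2 ^ (x.1 - j)) ((x.2 + 1) * 2 ^ (x.1 - j))).image fun i =>
      s(((j, i) : Vtx), parentV (j, i))

/-- The threshold weighting on the complete binary tree `T_k` (realized as
`T_{(k,0)}` inside `T_∞`) arising from the uniform random walk on `T_k`:
`4/3` on edges containing a leaf, `5/6` on edges containing the root `(k,0)`,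
`2/3` otherwise. -/
def thetaTk (k : ℕ) : Sym2 Vtx → ℝ := fun e =>
  if ∃ v ∈ e, v.1 = 0 then 4 / 3 else if ((k, 0) : Vtx) ∈ e then 5 / 6 else 2 / 3

/-- The edge from `v` to its parent. -/
def parentEdge (v : Vtx) : Sym2 Vtx := s(v, parentV v)

/-- `v` is a vertex of the complete binary tree with root `(K, 0)`. -/
def InTree (K : ℕ) (v : Vtx) : Prop := v.1 ≤ K ∧ v.2 < 2 ^ (K - v.1)

/-- `v` is a (weak) descendant of `z`. -/
def Under (v z : Vtx) : Prop := ∃ i : ℕ, parentV^[i] v = z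

/-- `F` contains the complete binary tree rooted at `(n, m)`. -/
def Full (F : Finset (Sym2 Vtx)) : ℕ → ℕ → Prop
  | 0, m => ((0, m) : Vtx) ∈ vset F
  | n + 1, m => parentEdge (n, 2 * m) ∈ F ∧ parentEdge (n, 2 * m + 1) ∈ F ∧
      Full F n (2 * m) ∧ Full F n (2 * m + 1)

/-- The vertices of `F` incident to an edge of the tree rooted at `(K, 0)` that is missing
from `F`. -/
def boundary (K : ℕ) (F : Finset (Sym2 Vtx)) : Finset Vtx :=
  (F.biUnion Sym2.toFinset).filter fun v => ∃ e ∈ TxFinset (K, 0), v ∈ e ∧ e ∉ F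

lemma mem_biUnion_toFinset {F : Finset (Sym2 Vtx)} {v : Vtx} :
    v ∈ F.biUnion Sym2.toFinset ↔ v ∈ vset F := by
  simp [vset]

lemma mem_boundary {K : ℕ} {F : Finset (Sym2 Vtx)} {v : Vtx} :
    v ∈ boundary K F ↔ v ∈ vset F ∧ ∃ e ∈ TxFinset (K, 0), v ∈ e ∧ e ∉ F := by
  rw [boundary, Finset.mem_filter, mem_biUnion_toFinset]

lemma mem_TxFinset {K : ℕ} {e : Sym2 Vtx} :
    e ∈ TxFinset (K, 0) ↔ ∃ v, InTree K v ∧ v.1 < K ∧ e = parentEdge v := by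
  simp only [TxFinset, Finset.mem_biUnion, Finset.mem_range, Finset.mem_image, Finset.mem_Ico]
  constructor
  · rintro ⟨j, hj, i, hi, rfl⟩
    exact ⟨(j, i), ⟨hj.le, by simpa using hi.2⟩, hj, rfl⟩
  · rintro ⟨⟨j, i⟩, h1, h2, rfl⟩
    exact ⟨j, h2, i, ⟨by simp, by simpa using h1.2⟩, rfl⟩

lemma mem_parentEdge {u v : Vtx} : u ∈ parentEdge v ↔ u = v ∨ u = parentV v := by
  simp [parentEdge]

lemma vset_union (F G : Finset (Sym2 Vtx)) : vset (F ∪ G) = vset F ∪ vset G := by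
  ext v
  simp only [vset, Finset.mem_union, Set.mem_ofPred_eq, Set.mem_union]
  constructor
  · rintro ⟨e, h | h, hv⟩
    · exact Or.inl ⟨e, h, hv⟩
    · exact Or.inr ⟨e, h, hv⟩
  · rintro (⟨e, h, hv⟩ | ⟨e, h, hv⟩)
    · exact ⟨e, Or.inl h, hv⟩
    · exact ⟨e, Or.inr h, hv⟩

lemma vset_of_parentEdge {F : Finset (Sym2 Vtx)} {v : Vtx} (h : parentEdge v ∈ F) :
    v ∈ vset F := ⟨_, h, by simp [mem_parentEdge]⟩

lemma parent_vset_of_parentEdge {F : Finset (Sym2 Vtx)} {v : Vtx} (h : parentEdge v ∈ F) :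
    parentV v ∈ vset F := ⟨_, h, by simp [mem_parentEdge]⟩

lemma InTree.parent {K : ℕ} {v : Vtx} (h : InTree K v) (hv : v.1 < K) :
    InTree K (parentV v) := by
  refine ⟨hv, ?_⟩
  have h2 := h.2
  have : K - v.1 = (K - (v.1 + 1)) + 1 := by omega
  rw [this, pow_succ] at h2
  simp only [parentV]
  omega

lemma InTree.left {K n m : ℕ} (h : InTree K (n + 1, m)) : InTree K (n, 2 * m) := by
  obtain ⟨h1, h2⟩ := h
  simp only at h1 h2
  refine ⟨by simp only; omega, ?_⟩
  have : K - n = (K - (n + 1)) + 1 := by omega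
  simp only [this, pow_succ]
  omega

lemma InTree.right {K n m : ℕ} (h : InTree K (n + 1, m)) : InTree K (n, 2 * m + 1) := by
  obtain ⟨h1, h2⟩ := h
  simp only at h1 h2
  refine ⟨by simp only; omega, ?_⟩
  have : K - n = (K - (n + 1)) + 1 := by omega
  simp only [this, pow_succ]
  omega

lemma InTree.of_mem {K : ℕ} {F : Finset (Sym2 Vtx)} (hF : F ⊆ TxFinset (K, 0)) {v : Vtx}
    (hv : v ∈ vset F) : InTree K v := by
  obtain ⟨e, he, hve⟩ := hv
  obtain ⟨u, hu, huK, rfl⟩ := mem_TxFinset.1 (hF he)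
  rcases mem_parentEdge.1 hve with rfl | rfl
  · exact hu
  · exact hu.parent huK

lemma parentV_left (n m : ℕ) : parentV (n, 2 * m) = (n + 1, m) := by
  simp [parentV]

lemma parentV_right (n m : ℕ) : parentV (n, 2 * m + 1) = (n + 1, m) := by
  simp only [parentV, Prod.mk.injEq, true_and]
  omega

lemma eq_child {y : Vtx} {n m : ℕ} (h : parentV y = (n + 1, m)) :
    y = (n, 2 * m) ∨ y = (n, 2 * m + 1) := by
  obtain ⟨a, b⟩ := y
  simp only [parentV, Prod.mk.injEq] at h
  simp only [Prod.mk.injEq]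
  omega

lemma Under.rfl' (v : Vtx) : Under v v := ⟨0, rfl⟩

lemma Under.trans {u v w : Vtx} (h : Under u v) (h' : Under v w) : Under u w := by
  obtain ⟨i, rfl⟩ := h
  obtain ⟨j, rfl⟩ := h'
  exact ⟨j + i, Function.iterate_add_apply _ _ _ _⟩

lemma Under.parent (v : Vtx) : Under v (parentV v) := ⟨1, rfl⟩

lemma Under.left (n m : ℕ) : Under (n, 2 * m) (n + 1, m) := ⟨1, parentV_left n m⟩

lemma Under.right (n m : ℕ) : Under (n, 2 * m + 1) (n + 1, m) := ⟨1, parentV_right n m⟩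

lemma iterate_parentV_fst (i : ℕ) (v : Vtx) : (parentV^[i] v).1 = v.1 + i := by
  induction i generalizing v with
  | zero => rfl
  | succ i ih => rw [Function.iterate_succ_apply, ih]; simp only [parentV]; omega

lemma Under.le {v z : Vtx} (h : Under v z) : v.1 ≤ z.1 := by
  obtain ⟨i, rfl⟩ := h
  rw [iterate_parentV_fst]; omega

lemma Under.eq {v z z' : Vtx} (h : Under v z) (h' : Under v z') (hz : z.1 = z'.1) : z = z' := by
  obtain ⟨i, rfl⟩ := h
  obtain ⟨j, rfl⟩ := h'
  rw [iterate_parentV_fst, iterate_parentV_fst] at hz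
  rw [show i = j by omega]

lemma Under.cases {z : Vtx} {n m : ℕ} (h : Under z (n + 1, m)) :
    z = (n + 1, m) ∨ Under z (n, 2 * m) ∨ Under z (n, 2 * m + 1) := by
  obtain ⟨i, hi⟩ := h
  cases i with
  | zero => exact Or.inl hi
  | succ i =>
    rw [Function.iterate_succ_apply'] at hi
    rcases eq_child hi with h | h
    · exact Or.inr (Or.inl ⟨i, h⟩)
    · exact Or.inr (Or.inr ⟨i, h⟩)

lemma Under.eq_or_parent {v z : Vtx} (h : Under v z) : v = z ∨ Under (parentV v) z := by
  obtain ⟨i, hi⟩ := h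
  cases i with
  | zero => exact Or.inl hi
  | succ i => exact Or.inr ⟨i, hi⟩

lemma Under.inTree {K : ℕ} {v z : Vtx} (h : Under v z) (hz : InTree K z) : InTree K v := by
  obtain ⟨i, rfl⟩ := h
  induction i with
  | zero => exact hz
  | succ i ih =>
    apply ih
    rw [Function.iterate_succ_apply'] at hz
    rcases eq_child (y := parentV^[i] v) rfl with h | h
    · rw [h]; exact hz.left
    · rw [h]; exact hz.right

lemma Full.mem_vset {F : Finset (Sym2 Vtx)} {n m : ℕ} (h : Full F n m) :
    ((n, m) : Vtx) ∈ vset F := by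
  cases n with
  | zero => exact h
  | succ n => rw [← parentV_left]; exact parent_vset_of_parentEdge h.1

lemma Full.under {F : Finset (Sym2 Vtx)} {n m : ℕ} (h : Full F n m) {z : Vtx}
    (hz : Under z (n, m)) : Full F z.1 z.2 := by
  induction n generalizing m with
  | zero =>
    have h0 := hz.le
    have := hz.eq (Under.rfl' z) (by simp only at h0 ⊢; omega)
    rw [← this]; exact h
  | succ n ih =>
    rcases hz.cases with rfl | h' | h'
    · exact h
    · exact ih h.2.2.1 h'
    · exact ih h.2.2.2 h'

lemma Full.right_of_untouched {F G : Finset (Sym2 Vtx)} {n m : ℕ} (h : Full (F ∪ G) n m)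
    (hF : ∀ v ∈ vset F, ¬ Under v (n, m)) : Full G n m := by
  induction n generalizing m with
  | zero =>
    have h' : ((0, m) : Vtx) ∈ vset (F ∪ G) := h
    rw [vset_union] at h'
    exact h'.resolve_left fun h'' => hF _ h'' (Under.rfl' _)
  | succ n ih =>
    obtain ⟨h1, h2, h3, h4⟩ := h
    refine ⟨(Finset.mem_union.1 h1).resolve_left fun h' => hF _ (vset_of_parentEdge h')
        (Under.left n m),
      (Finset.mem_union.1 h2).resolve_left fun h' => hF _ (vset_of_parentEdge h')
        (Under.right n m),
      ih h3 fun v hv hvu => hF v hv (hvu.trans (Under.left n m)),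
      ih h4 fun v hv hvu => hF v hv (hvu.trans (Under.right n m))⟩

lemma parentEdge_mem_of_not_boundary {K : ℕ} {F : Finset (Sym2 Vtx)} {u v : Vtx}
    (hu : u ∈ vset F) (hb : u ∉ boundary K F) (hv : InTree K v) (hvK : v.1 < K)
    (huv : u ∈ parentEdge v) : parentEdge v ∈ F := by
  by_contra hne
  exact hb (mem_boundary.2 ⟨hu, _, mem_TxFinset.2 ⟨v, hv, hvK, rfl⟩, huv, hne⟩)

lemma mem_vset_of_no_boundary {K : ℕ} {F : Finset (Sym2 Vtx)} (hF : F ⊆ TxFinset (K, 0))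
    {v z : Vtx} (hz : InTree K z) (hv : v ∈ vset F) (hvz : Under v z)
    (hb : ∀ u ∈ boundary K F, ¬ Under u z) : z ∈ vset F := by
  obtain ⟨i, hi⟩ := hvz
  induction i generalizing v with
  | zero => rw [← hi]; exact hv
  | succ i ih =>
    have hlt : v.1 < K := by
      have := iterate_parentV_fst (i + 1) v
      rw [hi] at this
      have := hz.1
      omega
    have : parentEdge v ∈ F := parentEdge_mem_of_not_boundary hv
      (fun h => hb v h ⟨i + 1, hi⟩) (InTree.of_mem hF hv) hlt (by simp [mem_parentEdge])
    exact ih (parent_vset_of_parentEdge this) hi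

lemma full_of_no_boundary {K : ℕ} {F : Finset (Sym2 Vtx)} {n m : ℕ} (hz : InTree K (n, m))
    (hv : ((n, m) : Vtx) ∈ vset F) (hb : ∀ u ∈ boundary K F, ¬ Under u (n, m)) :
    Full F n m := by
  induction n generalizing m with
  | zero => exact hv
  | succ n ih =>
    have hnb : ((n + 1, m) : Vtx) ∉ boundary K F := fun h => hb _ h (Under.rfl' _)
    have h1 : parentEdge (n, 2 * m) ∈ F := parentEdge_mem_of_not_boundary hv hnb hz.left
      (by have := hz.1; simp only at this ⊢; omega) (mem_parentEdge.2 (Or.inr (parentV_left n m).symm))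
    have h2 : parentEdge (n, 2 * m + 1) ∈ F := parentEdge_mem_of_not_boundary hv hnb hz.right
      (by have := hz.1; simp only at this ⊢; omega)
      (mem_parentEdge.2 (Or.inr (parentV_right n m).symm))
    exact ⟨h1, h2, ih hz.left (vset_of_parentEdge h1) fun u hu hu' => hb u hu (hu'.trans (Under.left n m)),
      ih hz.right (vset_of_parentEdge h2) fun u hu hu' => hb u hu (hu'.trans (Under.right n m))⟩

lemma exists_boundary {K : ℕ} {F : Finset (Sym2 Vtx)} (hF : F ⊆ TxFinset (K, 0)) {n m : ℕ}
    (hz : InTree K (n, m)) {v : Vtx} (hv : v ∈ vset F) (hvz : Under v (n, m))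
    (hfull : ¬ Full F n m) : ∃ u ∈ boundary K F, Under u (n, m) := by
  by_contra! hb
  exact hfull (full_of_no_boundary hz (mem_vset_of_no_boundary hF hz hv hvz hb) hb)

/-- Boundary vertices of `F` below `z`. -/
def boundaryUnder (K : ℕ) (F : Finset (Sym2 Vtx)) (z : Vtx) : Finset Vtx :=
  (boundary K F).filter fun u => Under u z

lemma boundaryUnder_card_le (K : ℕ) (F : Finset (Sym2 Vtx)) (z : Vtx) :
    (boundaryUnder K F z).card ≤ (boundary K F).card :=
  Finset.card_le_card (Finset.filter_subset _ _)

lemma boundaryUnder_card_add_le (K : ℕ) (F : Finset (Sym2 Vtx)) {x y z : Vtx} (hx : Under x z)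
    (hy : Under y z) (hxy : x ≠ y) (h1 : x.1 = y.1) :
    (boundaryUnder K F x).card + (boundaryUnder K F y).card ≤ (boundaryUnder K F z).card := by
  rw [← Finset.card_union_of_disjoint]
  · apply Finset.card_le_card
    intro u hu
    simp only [boundaryUnder, Finset.mem_union, Finset.mem_filter] at hu ⊢
    rcases hu with ⟨h, h'⟩ | ⟨h, h'⟩
    · exact ⟨h, h'.trans hx⟩
    · exact ⟨h, h'.trans hy⟩
  · rw [Finset.disjoint_left]
    intro u hu hu'
    simp only [boundaryUnder, Finset.mem_filter] at hu hu'
    exact hxy (hu.2.eq hu'.2 h1)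

lemma two_pow_le_boundaryUnder {K : ℕ} {F : Finset (Sym2 Vtx)} (hF : F ⊆ TxFinset (K, 0))
    {n u m : ℕ} (hz : InTree K (n + u, m))
    (h : ∀ i, Under (n, i) (n + u, m) → (∃ v ∈ vset F, Under v (n, i)) ∧ ¬ Full F n i) :
    2 ^ u ≤ (boundaryUnder K F (n + u, m)).card := by
  induction u generalizing m with
  | zero =>
    obtain ⟨⟨v, hv, hvz⟩, hfull⟩ := h m (Under.rfl' _)
    obtain ⟨w, hw, hwz⟩ := exists_boundary hF hz hv hvz hfull
    exact Finset.card_pos.2 ⟨w, Finset.mem_filter.2 ⟨hw, hwz⟩⟩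
  | succ u ih =>
    have h1 := ih (InTree.left hz) fun i hi => h i (hi.trans (Under.left _ _))
    have h2 := ih (InTree.right hz) fun i hi => h i (hi.trans (Under.right _ _))
    have h3 := boundaryUnder_card_add_le K F (Under.left (n + u) m) (Under.right (n + u) m)
      (by simp) rfl
    rw [pow_succ]
    exact (by omega : 2 ^ u * 2 ≤ _).trans h3

lemma exists_under (n u m : ℕ) : ∃ i, Under (n, i) (n + u, m) := by
  induction u generalizing m with
  | zero => exact ⟨m, Under.rfl' _⟩
  | succ u ih =>
    obtain ⟨i, hi⟩ := ih (2 * m)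
    exact ⟨i, hi.trans (Under.left _ _)⟩

/-- If two graphs together contain a complete tree then one of them contains a subtree of
height `j`, or contains a smaller complete subtree and has large boundary. -/
lemma full_union_cases {K : ℕ} {F G : Finset (Sym2 Vtx)} (hF : F ⊆ TxFinset (K, 0))
    (hG : G ⊆ TxFinset (K, 0)) {n m : ℕ} (hz : InTree K (n, m)) (h : Full (F ∪ G) n m) {j : ℕ}
    (hj : j ≤ n) :
    (∃ i, Under (j, i) (n, m) ∧ (Full F j i ∨ Full G j i)) ∨
    ∃ H, (H = F ∨ H = G) ∧ ∃ j' i, j' < j ∧ Under (j', i) (n, m) ∧ Full H j' i ∧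
      2 ^ (n - j' - 1) ≤ (boundary K H).card := by
  induction j with
  | zero =>
    obtain ⟨i, hi⟩ := exists_under 0 n m
    rw [zero_add] at hi
    have h0 : ((0, i) : Vtx) ∈ vset (F ∪ G) := h.under hi
    rw [vset_union] at h0
    exact Or.inl ⟨i, hi, h0⟩
  | succ j ih =>
    rcases ih (by omega) with ⟨i, hi, hi'⟩ | ⟨H, hH, j', i, hj', hrest⟩
    · by_cases hP : ∃ i, Under (j + 1, i) (n, m) ∧ (Full F (j + 1) i ∨ Full G (j + 1) i)
      · exact Or.inl hP
      · push Not at hP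
        right
        obtain ⟨u, rfl⟩ : ∃ u, n = j + 1 + u := ⟨n - (j + 1), by omega⟩
        have hu : j + 1 + u - j - 1 = u := by omega
        rcases hi' with hi' | hi'
        · refine ⟨F, Or.inl rfl, j, i, by omega, hi, hi', ?_⟩
          rw [hu]
          refine (two_pow_le_boundaryUnder hF hz fun y hy => ⟨?_, (hP y hy).1⟩).trans
            (boundaryUnder_card_le _ _ _)
          by_contra! hunt
          exact (hP y hy).2 ((h.under hy).right_of_untouched hunt)
        · refine ⟨G, Or.inr rfl, j, i, by omega, hi, hi', ?_⟩
          rw [hu]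
          refine (two_pow_le_boundaryUnder hG hz fun y hy => ⟨?_, (hP y hy).2⟩).trans
            (boundaryUnder_card_le _ _ _)
          by_contra! hunt
          rw [Finset.union_comm] at h
          exact (hP y hy).1 ((h.under hy).right_of_untouched hunt)
    · exact Or.inr ⟨H, hH, j', i, by omega, hrest⟩

lemma reachable_of_mem {F : Finset (Sym2 Vtx)} {e : Sym2 Vtx} (he : e ∈ F) {a b : Vtx}
    (ha : a ∈ e) (hb : b ∈ e) :
    (SimpleGraph.fromEdgeSet (F : Set (Sym2 Vtx))).Reachable a b := by
  by_cases hab : a = b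
  · rw [hab]
  · apply SimpleGraph.Adj.reachable
    rw [SimpleGraph.fromEdgeSet_adj]
    exact ⟨by rw [← (Sym2.mem_and_mem_iff hab).1 ⟨ha, hb⟩]; exact he, hab⟩

lemma Full.elimS {F : Finset (Sym2 Vtx)} {S : Set Vtx} {n m : ℕ} (h : Full F n m)
    (hS : ∀ s ∈ S, ¬ (SimpleGraph.fromEdgeSet (F : Set (Sym2 Vtx))).Reachable (n, m) s) :
    Full (elimS F S) n m := by
  have key : ∀ e ∈ F, ((n, m) : Vtx) ∈ e → e ∈ Paper.elimS F S := by
    intro e he hme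
    refine Finset.mem_filter.2 ⟨he, fun v hv s hs hr => hS s hs ?_⟩
    exact (reachable_of_mem he hme hv).trans hr
  induction n generalizing m with
  | zero =>
    obtain ⟨e, he, hme⟩ := h
    exact ⟨e, key e he hme, hme⟩
  | succ n ih =>
    obtain ⟨h1, h2, h3, h4⟩ := h
    have e1 : ((n + 1, m) : Vtx) ∈ parentEdge (n, 2 * m) :=
      mem_parentEdge.2 (Or.inr (parentV_left n m).symm)
    have e2 : ((n + 1, m) : Vtx) ∈ parentEdge (n, 2 * m + 1) :=
      mem_parentEdge.2 (Or.inr (parentV_right n m).symm)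
    have hS1 : ∀ s ∈ S, ¬ (SimpleGraph.fromEdgeSet (F : Set (Sym2 Vtx))).Reachable
        (n, 2 * m) s := fun s hs hr => hS s hs
      ((reachable_of_mem h1 e1 (mem_parentEdge.2 (Or.inl rfl))).trans hr)
    have hS2 : ∀ s ∈ S, ¬ (SimpleGraph.fromEdgeSet (F : Set (Sym2 Vtx))).Reachable
        (n, 2 * m + 1) s := fun s hs hr => hS s hs
      ((reachable_of_mem h2 e2 (mem_parentEdge.2 (Or.inl rfl))).trans hr)
    refine ⟨key _ h1 e1, key _ h2 e2, ih h3 hS1 ?_, ih h4 hS2 ?_⟩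
    · exact fun e he hme => Finset.mem_filter.2 ⟨he, fun v hv s hs hr =>
        hS1 s hs ((reachable_of_mem he hme hv).trans hr)⟩
    · exact fun e he hme => Finset.mem_filter.2 ⟨he, fun v hv s hs hr =>
        hS2 s hs ((reachable_of_mem he hme hv).trans hr)⟩

lemma under_of_reachable {K : ℕ} {F : Finset (Sym2 Vtx)} (hF : F ⊆ TxFinset (K, 0)) {p a b : Vtx}
    (hp : parentEdge p ∉ F) (ha : Under a p)
    (hr : (SimpleGraph.fromEdgeSet (F : Set (Sym2 Vtx))).Reachable a b) : Under b p := by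
  obtain ⟨w⟩ := hr
  induction w with
  | nil => exact ha
  | @cons u v w hadj _ ih =>
    apply ih
    rw [SimpleGraph.fromEdgeSet_adj] at hadj
    obtain ⟨hmem, hne⟩ := hadj
    obtain ⟨y, -, -, hy⟩ := mem_TxFinset.1 (hF hmem)
    have hu : u ∈ parentEdge y := by rw [← hy]; simp
    have hv : v ∈ parentEdge y := by rw [← hy]; simp
    rw [hy] at hmem
    rcases mem_parentEdge.1 hv with rfl | rfl
    · rcases mem_parentEdge.1 hu with rfl | rfl
      · exact ha
      · exact (Under.parent _).trans ha
    · rcases mem_parentEdge.1 hu with rfl | rfl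
      · rcases ha.eq_or_parent with rfl | h
        · exact absurd hmem hp
        · exact h
      · exact ha

/-- A path upwards from the root `w` of a maximal complete subtree creates one boundary vertex
for each step. -/
lemma le_boundaryUnder_of_path {K : ℕ} {F : Finset (Sym2 Vtx)} (hF : F ⊆ TxFinset (K, 0))
    {w z : Vtx} (hz : InTree K z) (hw : Full F w.1 w.2)
    (hmax : ∀ y : Vtx, Under y z → Full F y.1 y.2 → y.1 ≤ w.1)
    (i : ℕ) (hi : Under (parentV^[i] w) z) (hedge : ∀ j < i, parentEdge (parentV^[j] w) ∈ F) :
    i ≤ (boundaryUnder K F (parentV^[i] w)).card := by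
  induction i with
  | zero => exact Nat.zero_le _
  | succ i ih =>
    rw [Function.iterate_succ_apply'] at hi ⊢
    set y := parentV^[i] w with hy
    have hy1 : y.1 = w.1 + i := iterate_parentV_fst i w
    have ih' := ih ((Under.parent y).trans hi) fun j hj => hedge j (by omega)
    have hyF : parentEdge y ∈ F := hedge i (by omega)
    obtain ⟨n, m, hnm⟩ : ∃ n m, parentV y = (n + 1, m) := ⟨y.1, y.2 / 2, rfl⟩
    have hn : y.1 = n := by
      have := congrArg Prod.fst hnm
      simp only [parentV] at this
      omega
    have hpv : ((n + 1, m) : Vtx) ∈ vset F := by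
      rw [← hnm]; exact parent_vset_of_parentEdge hyF
    rw [hnm] at hi ⊢
    have hin : InTree K (n + 1, m) := hi.inTree hz
    have hnotfull : ¬ Full F (n + 1) m := fun h => by
      have := hmax _ hi h
      simp only at this
      omega
    suffices h : ∃ b ∈ boundaryUnder K F (n + 1, m), ¬ Under b y by
      obtain ⟨b, hb, hby⟩ := h
      have hlt : (boundaryUnder K F y) ⊂ (boundaryUnder K F (n + 1, m)) := by
        refine Finset.ssubset_iff_subset_ne.2 ⟨?_, ?_⟩
        · intro u hu
          have hu' := Finset.mem_filter.1 hu
          exact Finset.mem_filter.2 ⟨hu'.1, hu'.2.trans (hnm ▸ Under.parent y)⟩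
        · intro heq
          rw [← heq] at hb
          exact hby (Finset.mem_filter.1 hb).2
      have := Finset.card_lt_card hlt
      omega
    by_contra! hall
    have hnb : ((n + 1, m) : Vtx) ∉ boundary K F := fun hb => by
      have := (hall _ (Finset.mem_filter.2 ⟨hb, Under.rfl' _⟩)).le
      simp only at this
      omega
    have h1 : parentEdge (n, 2 * m) ∈ F := parentEdge_mem_of_not_boundary hpv hnb hin.left
      (by have := hin.1; simp only at this ⊢; omega)
      (mem_parentEdge.2 (Or.inr (parentV_left n m).symm))
    have h2 : parentEdge (n, 2 * m + 1) ∈ F := parentEdge_mem_of_not_boundary hpv hnb hin.right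
      (by have := hin.1; simp only at this ⊢; omega)
      (mem_parentEdge.2 (Or.inr (parentV_right n m).symm))
    have sibling : ∀ q : Vtx, q.1 = n → Under q (n + 1, m) → q ≠ y → parentEdge q ∈ F →
        Full F q.1 q.2 := by
      intro q hq hqu hqy hqF
      by_contra hnf
      obtain ⟨b, hb, hbq⟩ := exists_boundary hF (hqu.inTree hin) (vset_of_parentEdge hqF)
        (Under.rfl' q) hnf
      exact hqy (hbq.eq (hall b (Finset.mem_filter.2 ⟨hb, hbq.trans hqu⟩)) (hq.trans hn.symm))
    have hyfull : ∀ q : Vtx, q.1 = n → Under q (n + 1, m) → q ≠ y → Full F q.1 q.2 →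
        Full F y.1 y.2 := by
      intro q hq hqu _ hqfull
      have := hmax q (hqu.trans hi) hqfull
      have hi0 : i = 0 := by omega
      rw [hy, hi0]
      exact hw
    rcases eq_child hnm with hyc | hyc
    · have hq : ((n, 2 * m + 1) : Vtx) ≠ y := by rw [hyc]; simp
      have hf := sibling (n, 2 * m + 1) rfl (Under.right n m) hq h2
      have hf' := hyfull (n, 2 * m + 1) rfl (Under.right n m) hq hf
      rw [hyc] at hf'
      exact hnotfull ⟨h1, h2, hf', hf⟩
    · have hq : ((n, 2 * m) : Vtx) ≠ y := by rw [hyc]; simp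
      have hf := sibling (n, 2 * m) rfl (Under.left n m) hq h1
      have hf' := hyfull (n, 2 * m) rfl (Under.left n m) hq hf
      rw [hyc] at hf'
      exact hnotfull ⟨h1, h2, hf, hf'⟩

/-- The inverse degree of a vertex of the complete binary tree of height `K`. -/
def invDegree (K : ℕ) (v : Vtx) : ℝ :=
  if v.1 = 0 then 1 else if v = (K, 0) then 1 / 2 else 1 / 3

lemma invDegree_ge (K : ℕ) (v : Vtx) : 1 / 3 ≤ invDegree K v := by
  unfold invDegree
  split_ifs <;> norm_num

lemma thetaTk_parentEdge {K : ℕ} (hK : 2 ≤ K) {v : Vtx} (hv : v.1 < K) :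
    thetaTk K (parentEdge v) = invDegree K v + invDegree K (parentV v) := by
  have h1 : (∃ u ∈ parentEdge v, u.1 = 0) ↔ v.1 = 0 := by
    constructor
    · rintro ⟨u, hu, hu0⟩
      rcases mem_parentEdge.1 hu with rfl | rfl
      · exact hu0
      · simp [parentV] at hu0
    · exact fun h => ⟨v, mem_parentEdge.2 (Or.inl rfl), h⟩
  have hne : v ≠ (K, 0) := by rintro rfl; simp at hv
  have h2 : ((K, 0) : Vtx) ∈ parentEdge v ↔ parentV v = (K, 0) := by
    rw [mem_parentEdge]
    exact ⟨fun h => (h.resolve_left hne.symm).symm, fun h => Or.inr h.symm⟩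
  have h3 : (parentV v).1 ≠ 0 := by simp [parentV]
  simp only [thetaTk, invDegree, h1, h2, h3, hne, if_false]
  by_cases h0 : v.1 = 0
  · have : parentV v ≠ (K, 0) := by
      intro h
      have := congrArg Prod.fst h
      simp only [parentV] at this
      omega
    simp only [h0, this, if_true, if_false]
    norm_num
  · simp only [h0, if_false]
    split_ifs <;> norm_num

lemma card_incident_mul_le (K : ℕ) (v : Vtx) :
    invDegree K v * (((TxFinset (K, 0)).filter fun e => v ∈ e).card : ℝ) ≤ 1 := by
  obtain ⟨n, m⟩ := v
  unfold invDegree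
  have hcases : ∀ e ∈ (TxFinset (K, 0)).filter fun e => ((n, m) : Vtx) ∈ e,
      (n < K ∧ e = parentEdge (n, m)) ∨ ∃ y : Vtx, parentV y = (n, m) ∧ e = parentEdge y := by
    intro e he
    obtain ⟨he, hv⟩ := Finset.mem_filter.1 he
    obtain ⟨y, -, hyK, rfl⟩ := mem_TxFinset.1 he
    rcases mem_parentEdge.1 hv with rfl | h
    · exact Or.inl ⟨hyK, rfl⟩
    · exact Or.inr ⟨y, h.symm, rfl⟩
  rcases n with _ | n
  · have hsub : ((TxFinset (K, 0)).filter fun e => ((0, m) : Vtx) ∈ e) ⊆ {parentEdge (0, m)} := by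
      intro e he
      rcases hcases e he with ⟨-, h⟩ | ⟨y, hy, -⟩
      · simpa using h
      · simp [parentV] at hy
    have h1 := Finset.card_le_card hsub
    rw [Finset.card_singleton] at h1
    have h2 : (((TxFinset (K, 0)).filter fun e => ((0, m) : Vtx) ∈ e).card : ℝ) ≤ 1 := by
      exact_mod_cast h1
    simpa using h2
  · have hne : (n + 1 = 0) = False := by simp
    simp only [hne, if_false]
    split_ifs with h
    · have hsub : ((TxFinset (K, 0)).filter fun e => ((n + 1, m) : Vtx) ∈ e) ⊆
          {parentEdge (n, 2 * m), parentEdge (n, 2 * m + 1)} := by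
        intro e he
        rcases hcases e he with ⟨h', -⟩ | ⟨y, hy, rfl⟩
        · have := congrArg Prod.fst h
          simp only at this
          omega
        · rcases eq_child hy with rfl | rfl <;> simp
      have h1 := (Finset.card_le_card hsub).trans Finset.card_le_two
      have h2 : (((TxFinset (K, 0)).filter fun e => ((n + 1, m) : Vtx) ∈ e).card : ℝ) ≤ 2 := by
        exact_mod_cast h1
      linarith
    · have hsub : ((TxFinset (K, 0)).filter fun e => ((n + 1, m) : Vtx) ∈ e) ⊆
          {parentEdge (n + 1, m), parentEdge (n, 2 * m), parentEdge (n, 2 * m + 1)} := by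
        intro e he
        rcases hcases e he with ⟨-, rfl⟩ | ⟨y, hy, rfl⟩
        · simp
        · rcases eq_child hy with rfl | rfl <;> simp
      have h1 := (Finset.card_le_card hsub).trans Finset.card_le_three
      have h2 : (((TxFinset (K, 0)).filter fun e => ((n + 1, m) : Vtx) ∈ e).card : ℝ) ≤ 3 := by
        exact_mod_cast h1
      linarith

lemma sum_toFinset_parentEdge (v : Vtx) (w : Vtx → ℝ) :
    ∑ u ∈ (parentEdge v).toFinset, w u = w v + w (parentV v) := by
  have : (parentEdge v).toFinset = {v, parentV v} := by
    ext u
    simp [mem_parentEdge]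
  rw [this, Finset.sum_pair]
  intro h
  have := congrArg Prod.fst h
  simp [parentV] at this

lemma vset_ncard (F : Finset (Sym2 Vtx)) :
    (vset F).ncard = (F.biUnion Sym2.toFinset).card := by
  rw [← Set.ncard_coe_finset]
  congr 1
  ext v
  rw [Finset.mem_coe, mem_biUnion_toFinset]

lemma delta_eq_sum {K : ℕ} (hK : 2 ≤ K) {F : Finset (Sym2 Vtx)} (hF : F ⊆ TxFinset (K, 0)) :
    Delta (thetaTk K) F = ∑ v ∈ F.biUnion Sym2.toFinset,
      (1 - invDegree K v * ((F.filter fun e => v ∈ e).card : ℝ)) := by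
  have hsum : ∑ e ∈ F, thetaTk K e = ∑ v ∈ F.biUnion Sym2.toFinset,
      invDegree K v * ((F.filter fun e => v ∈ e).card : ℝ) := by
    calc ∑ e ∈ F, thetaTk K e
        = ∑ e ∈ F, ∑ v ∈ F.biUnion Sym2.toFinset, if v ∈ e then invDegree K v else 0 := by
          refine Finset.sum_congr rfl fun e he => ?_
          obtain ⟨y, -, hyK, rfl⟩ := mem_TxFinset.1 (hF he)
          rw [thetaTk_parentEdge hK hyK, ← sum_toFinset_parentEdge y (invDegree K),
            ← Finset.sum_filter]
          refine Finset.sum_congr ?_ fun _ _ => rfl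
          ext v
          simp only [Sym2.mem_toFinset, Finset.mem_filter, mem_biUnion_toFinset]
          exact ⟨fun h => ⟨⟨_, he, h⟩, h⟩, fun h => h.2⟩
      _ = _ := by
          rw [Finset.sum_comm]
          refine Finset.sum_congr rfl fun v _ => ?_
          rw [← Finset.sum_filter, Finset.sum_const, nsmul_eq_mul, mul_comm]
  rw [Delta, hsum, vset_ncard, Finset.sum_sub_distrib, Finset.sum_const, nsmul_eq_mul, mul_one]

lemma boundary_card_le_delta {K : ℕ} (hK : 2 ≤ K) {F : Finset (Sym2 Vtx)}
    (hF : F ⊆ TxFinset (K, 0)) : ((boundary K F).card : ℝ) / 3 ≤ Delta (thetaTk K) F := by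
  have hpos : ∀ v, 0 ≤ 1 - invDegree K v * ((F.filter fun e => v ∈ e).card : ℝ) := by
    intro v
    have h1 : ((F.filter fun e => v ∈ e).card : ℝ) ≤
        ((TxFinset (K, 0)).filter fun e => v ∈ e).card := by
      exact_mod_cast Finset.card_le_card (Finset.filter_subset_filter _ hF)
    have h2 := card_incident_mul_le K v
    have h3 := invDegree_ge K v
    nlinarith
  have hbd : ∀ v ∈ boundary K F,
      (1 / 3 : ℝ) ≤ 1 - invDegree K v * ((F.filter fun e => v ∈ e).card : ℝ) := by
    intro v hv
    obtain ⟨-, e, he, hve, heF⟩ := mem_boundary.1 hv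
    have hlt : (F.filter fun e => v ∈ e) ⊂ ((TxFinset (K, 0)).filter fun e => v ∈ e) := by
      refine Finset.ssubset_iff_subset_ne.2 ⟨Finset.filter_subset_filter _ hF, fun heq => ?_⟩
      have : e ∈ F.filter fun e => v ∈ e := by
        rw [heq]
        exact Finset.mem_filter.2 ⟨he, hve⟩
      exact heF (Finset.mem_filter.1 this).1
    have h1 : ((F.filter fun e => v ∈ e).card : ℝ) + 1 ≤
        ((TxFinset (K, 0)).filter fun e => v ∈ e).card := by
      exact_mod_cast Finset.card_lt_card hlt
    have h2 := card_incident_mul_le K v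
    have h3 := invDegree_ge K v
    nlinarith
  rw [delta_eq_sum hK hF]
  calc ((boundary K F).card : ℝ) / 3 = ∑ v ∈ boundary K F, (1 / 3 : ℝ) := by
        rw [Finset.sum_const, nsmul_eq_mul]; ring
    _ ≤ ∑ v ∈ boundary K F, (1 - invDegree K v * ((F.filter fun e => v ∈ e).card : ℝ)) :=
        Finset.sum_le_sum hbd
    _ ≤ _ := Finset.sum_le_sum_of_subset_of_nonneg (Finset.filter_subset _ _)
        fun v _ _ => hpos v

lemma delta_nonneg {K : ℕ} (hK : 2 ≤ K) {F : Finset (Sym2 Vtx)}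
    (hF : F ⊆ TxFinset (K, 0)) : 0 ≤ Delta (thetaTk K) F :=
  le_trans (by positivity) (boundary_card_le_delta hK hF)

lemma delta_le {K : ℕ} (hK : 2 ≤ K) {F : Finset (Sym2 Vtx)} (hF : F ⊆ TxFinset (K, 0)) :
    Delta (thetaTk K) F ≤ (((TxFinset (K, 0)).biUnion Sym2.toFinset).card : ℝ) := by
  have h1 : 0 ≤ ∑ e ∈ F, thetaTk K e := Finset.sum_nonneg fun e he => by
    obtain ⟨y, -, hyK, rfl⟩ := mem_TxFinset.1 (hF he)
    rw [thetaTk_parentEdge hK hyK]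
    have := invDegree_ge K y
    have := invDegree_ge K (parentV y)
    linarith
  have h2 : ((F.biUnion Sym2.toFinset).card : ℝ) ≤
      ((TxFinset (K, 0)).biUnion Sym2.toFinset).card := by
    exact_mod_cast Finset.card_le_card (Finset.biUnion_subset_biUnion_of_subset_left _ hF)
  rw [Delta, vset_ncard]
  linarith

namespace JoinTree

lemma graph_prune (A : JoinTree V) (F : Finset (Sym2 V)) : (prune A F).graph = A.graph ∩ F := by
  induction A with
  | leaf l =>
    cases l with
    | none => simp [prune, graph]
    | some e =>
      simp only [prune]
      split_ifs with h <;> simp [graph, h]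
  | node B C hB hC => simp only [prune, graph, hB, hC, Finset.union_inter_distrib_right]

lemma graph_elimT (A : JoinTree V) (S : Set V) : (elimT A S).graph = elimS A.graph S := by
  rw [elimT, graph_prune]
  exact Finset.inter_eq_right.2 (elimS_subset _ _)

lemma Sub.trans {A B C : JoinTree V} (h : Sub A B) (h' : Sub B C) : Sub A C := by
  induction h' with
  | empty =>
    cases h
    · exact Sub.empty _
    · exact Sub.empty _
  | refl => exact h
  | left _ ih => exact (ih h).left
  | right _ ih => exact (ih h).right

lemma Sub.subP_of_size_lt {D A : JoinTree V} (h : Sub D A) (hs : D.size < A.size) : SubP D A :=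
  ⟨h, by rintro rfl; omega⟩

lemma Sub.subP_left {B C A : JoinTree V} (h : Sub (node B C) A) : SubP B A :=
  ((Sub.refl B).left.trans h).subP_of_size_lt
    (lt_of_lt_of_le (by simp only [size]; omega) h.size_le)

lemma Sub.subP_right {B C A : JoinTree V} (h : Sub (node B C) A) : SubP C A :=
  ((Sub.refl C).right.trans h).subP_of_size_lt
    (lt_of_lt_of_le (by simp only [size]; omega) h.size_le)

/-- A property of join-trees that fails for atoms has a minimal witness. -/
lemma exists_minimal_node (P : JoinTree V → Prop) (hP : ∀ l, ¬ P (leaf l)) {A : JoinTree V}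
    (hA : P A) : ∃ B C, Sub (node B C) A ∧ P (node B C) ∧ ¬ P B ∧ ¬ P C := by
  induction A with
  | leaf l => exact absurd hA (hP l)
  | node B C hB hC =>
    by_cases h1 : P B
    · obtain ⟨X, Y, h, h'⟩ := hB h1
      exact ⟨X, Y, h.left, h'⟩
    by_cases h2 : P C
    · obtain ⟨X, Y, h, h'⟩ := hC h2
      exact ⟨X, Y, h.right, h'⟩
    exact ⟨B, C, Sub.refl _, hA, h1, h2⟩

lemma not_full_leaf (l : Option (Sym2 Vtx)) (n m : ℕ) : ¬ Full (leaf l).graph (n + 1) m := by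
  rintro ⟨h1, h2, -, -⟩
  cases l with
  | none => simp [graph] at h1
  | some e =>
    simp only [graph, Finset.mem_singleton] at h1 h2
    have : ((n, 2 * m) : Vtx) ∈ parentEdge (n, 2 * m + 1) := by
      rw [h2, ← h1]; exact mem_parentEdge.2 (Or.inl rfl)
    rcases mem_parentEdge.1 this with h | h <;> simp [parentV] at h

end JoinTree

lemma exists_phiOk {K : ℕ} (hK : 2 ≤ K) :
    ∃ f : JoinTree Vtx → ℝ, PhiOk (↑(TxFinset (K, 0))) (thetaTk K) f := by
  obtain ⟨c, hc⟩ : ∃ c : ℝ, c = (((TxFinset (K, 0)).biUnion Sym2.toFinset).card : ℝ) := ⟨_, rfl⟩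
  have hc0 : 0 ≤ c := by rw [hc]; positivity
  have hΔ : ∀ (A : JoinTree Vtx), Over (↑(TxFinset (K, 0))) A → ∀ F ⊆ A.graph,
      Delta (thetaTk K) F ≤ c := fun A hA F hF =>
    hc ▸ delta_le hK (hF.trans (Finset.coe_subset.1 hA))
  have hmono : ∀ {a b : ℕ}, a ≤ b → 2 * c * (a : ℝ) ≤ 2 * c * b := fun h =>
    mul_le_mul_of_nonneg_left (by exact_mod_cast h) (by linarith)
  refine ⟨fun A => 2 * c * A.size, fun A _ => by positivity, ?_, ?_, ?_, ?_⟩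
  · rintro A hA ⟨l, rfl⟩
    cases l with
    | none => simp [graph, size, Delta, vset]
    | some e =>
      have := hΔ _ hA _ subset_rfl
      simp only [size, Nat.cast_one]
      linarith
  · intro B C D hA hD
    have h1 := hΔ _ hA (elimS C.graph (vset D.graph))
      ((elimS_subset _ _).trans (graph_mono_of_sub (Sub.refl C).right))
    have h2 := hΔ _ hA _ (elimS_subset _ (vset C.graph ∪ vset D.graph))
    have h3 := hmono (show D.size + 1 ≤ (node B C).size by
      have := hD.size_le; simp only [size]; omega)
    push_cast at h3
    linarith
  · intro B C D hA hD
    have h1 := hΔ _ hA (elimS B.graph (vset D.graph))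
      ((elimS_subset _ _).trans (graph_mono_of_sub (Sub.refl B).left))
    have h2 := hΔ _ hA _ (elimS_subset _ (vset B.graph ∪ vset D.graph))
    have h3 := hmono (show D.size + 1 ≤ (node B C).size by
      have := hD.size_le; simp only [size]; omega)
    push_cast at h3
    linarith
  · intro A D E hA hD hE
    have h1 := hΔ _ hA _ subset_rfl
    have h2 := hΔ _ hA _ (elimS_subset _ (vset D.graph ∪ vset E.graph))
    have h3 := hmono (Nat.succ_le_of_lt hD.size_lt)
    have h4 := hmono (Nat.succ_le_of_lt
      ((size_prune_le E (elimS E.graph (vset D.graph))).trans_lt hE.size_lt))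
    push_cast at h3 h4
    simp only [elimT]
    linarith

lemma PhiOk.mono_of_sub {K : ℕ} (hK : 2 ≤ K) {f : JoinTree Vtx → ℝ}
    (hf : PhiOk (↑(TxFinset (K, 0))) (thetaTk K) f) {D A : JoinTree Vtx}
    (hA : A.graph ⊆ TxFinset (K, 0)) (h : Sub D A) (hD : D.graph.Nonempty) : f D ≤ f A := by
  induction h with
  | empty => simp [graph] at hD
  | refl => exact le_rfl
  | @left D B C _ ih =>
    have hB := graph_mono_of_sub (Sub.refl B).left (A := node B C)
    have hC := graph_mono_of_sub (Sub.refl C).right (A := node B C)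
    have h1 := hf.2.2.1 B C B (Finset.coe_subset.2 hA) (Sub.refl B)
    have h2 := delta_nonneg hK ((elimS_subset C.graph (vset B.graph)).trans (hC.trans hA))
    have h3 := delta_nonneg hK
      ((elimS_subset (node B C).graph (vset C.graph ∪ vset B.graph)).trans hA)
    have h4 := ih (hB.trans hA) hD
    linarith
  | @right D B C _ ih =>
    have hB := graph_mono_of_sub (Sub.refl B).left (A := node B C)
    have hC := graph_mono_of_sub (Sub.refl C).right (A := node B C)
    have h1 := hf.2.2.2.1 B C C (Finset.coe_subset.2 hA) (Sub.refl C)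
    have h2 := delta_nonneg hK ((elimS_subset B.graph (vset C.graph)).trans (hB.trans hA))
    have h3 := delta_nonneg hK
      ((elimS_subset (node B C).graph (vset B.graph ∪ vset C.graph)).trans hA)
    have h4 := ih (hC.trans hA) hD
    linarith

lemma PhiOk.delta_le {K : ℕ} {f : JoinTree Vtx → ℝ}
    (hf : PhiOk (↑(TxFinset (K, 0))) (thetaTk K) f) {A : JoinTree Vtx}
    (hA : A.graph ⊆ TxFinset (K, 0)) : Delta (thetaTk K) A.graph ≤ f A := by
  have hA' : Over (↑(TxFinset (K, 0))) A := Finset.coe_subset.2 hA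
  cases A with
  | leaf l => exact hf.2.1 _ hA' ⟨l, rfl⟩
  | node B C =>
    have hs : SubP (leaf none) (node B C) := ⟨Sub.empty _, by simp⟩
    have h := hf.2.2.2.2 (node B C) (leaf none) (leaf none) hA' hs hs
    have h0 : Over (↑(TxFinset (K, 0))) (leaf none : JoinTree Vtx) := by simp [Over, graph]
    have he : elimS (node B C).graph
        (vset (leaf none : JoinTree Vtx).graph ∪ vset (leaf none : JoinTree Vtx).graph) =
        (node B C).graph := by
      simp [elimS, vset, graph]
    have h1 := hf.1 _ h0
    have h2 : 0 ≤ f (elimT (leaf none) (vset (leaf none : JoinTree Vtx).graph)) :=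
      hf.1 _ (by simpa [elimT, prune] using h0)
    rw [he] at h
    linarith

lemma inTree_root (K : ℕ) : InTree K (K, 0) := ⟨le_rfl, by simp⟩

lemma under_root {K : ℕ} {v : Vtx} (hv : InTree K v) : Under v (K, 0) := by
  obtain ⟨d, hd⟩ : ∃ d, v.1 + d = K := ⟨K - v.1, by have := hv.1; omega⟩
  induction d generalizing v with
  | zero =>
    obtain ⟨a, b⟩ := v
    obtain ⟨-, h2⟩ := hv
    simp only [Nat.add_zero] at hd
    subst hd
    simp only [Nat.sub_self, pow_zero, Nat.lt_one_iff] at h2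
    subst h2
    exact Under.rfl' _
  | succ d ih =>
    exact (Under.parent v).trans (ih (hv.parent (by omega)) (by simp only [parentV]; omega))

lemma subset_of_full {K : ℕ} {F : Finset (Sym2 Vtx)} (h : Full F K 0) : TxFinset (K, 0) ⊆ F := by
  intro e he
  obtain ⟨v, hv, hvK, rfl⟩ := mem_TxFinset.1 he
  have hp := h.under (under_root (hv.parent hvK))
  obtain ⟨n, m, hnm⟩ : ∃ n m, parentV v = (n + 1, m) := ⟨v.1, v.2 / 2, rfl⟩
  rw [hnm] at hp
  rcases eq_child hnm with rfl | rfl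
  · exact hp.1
  · exact hp.2.1

lemma one_le_boundary_card {K : ℕ} {F : Finset (Sym2 Vtx)} (hF : F ⊂ TxFinset (K, 0)) {v : Vtx}
    (hv : v ∈ vset F) : 1 ≤ (boundary K F).card := by
  obtain ⟨u, hu, -⟩ := exists_boundary hF.1 (inTree_root K) hv
    (under_root (InTree.of_mem hF.1 hv)) fun h => hF.2 (subset_of_full h)
  exact Finset.card_pos.2 ⟨u, hu⟩

lemma full_TxFinset {K : ℕ} (hK : 1 ≤ K) : Full (TxFinset (K, 0)) K 0 := by
  refine full_of_no_boundary (K := K) (inTree_root K) ?_ fun u hu => ?_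
  · refine ⟨_, mem_TxFinset.2 ⟨(K - 1, 0), ⟨by simp, by simp⟩, by simp only; omega, rfl⟩, ?_⟩
    rw [mem_parentEdge]
    exact Or.inr (Prod.ext (Nat.sub_add_cancel hK).symm (by simp [parentV]))
  · obtain ⟨-, e, he, -, hne⟩ := mem_boundary.1 hu
    exact absurd he hne

lemma graph_node (B C : JoinTree Vtx) : (node B C).graph = B.graph ∪ C.graph := by
  ext e
  simp [graph]

lemma nonempty_of_full {F : Finset (Sym2 Vtx)} {n m : ℕ} (h : Full F n m) : F.Nonempty := by
  obtain ⟨e, he, -⟩ := h.mem_vset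
  exact ⟨e, he⟩

lemma le_three_mul_two_pow {a v : ℕ} (h : a + v + 1 ≤ 3 * 2 ^ v) {u : ℕ} (hu : v ≤ u) :
    a + u + 1 ≤ 3 * 2 ^ u := by
  induction u, hu using Nat.le_induction with
  | base => exact h
  | succ u _ ih =>
    have := Nat.one_le_two_pow (n := u)
    rw [pow_succ]
    omega

lemma seven_mul_le (c : ℕ) : 7 * (c + 1) ≤ 3 * 2 ^ c + 9 := by
  rcases lt_or_ge c 2 with h | h
  · interval_cases c <;> norm_num
  · induction c, h using Nat.le_induction with
    | base => norm_num
    | succ c hc ih =>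
      have : 2 ^ 2 ≤ 2 ^ c := Nat.pow_le_pow_right (by norm_num) hc
      rw [pow_succ]
      omega

lemma seven_mul_le_three_mul_two_pow {n : ℕ} (hn : 3 ≤ n) : 7 * n + 1 ≤ 3 * 2 ^ n := by
  induction n, hn using Nat.le_induction with
  | base => norm_num
  | succ n hn ih =>
    have : 2 ^ 3 ≤ 2 ^ n := Nat.pow_le_pow_right (by norm_num) hn
    rw [pow_succ]
    omega

lemma exists_scale {M : ℕ} (hM : 1 ≤ M) : ∃ s τ : ℕ, 1 ≤ s ∧ τ + 2 * s = 4 * M + 6 ∧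
    3 * M + 2 * s + 1 ≤ 3 * 2 ^ s ∧ 4 * s ≤ 4 * M + 6 ∧
    ∀ t, 2 * t + 1 ≤ 3 * M + 3 * s → t ≤ τ ∧ 3 * M + τ + 1 ≤ 3 * 2 ^ (τ - t) := by
  rcases Nat.lt_or_ge M 3 with h | h
  · have h5 : ∀ r, 5 ≤ r → 96 ≤ 3 * 2 ^ r := fun r hr => by
      have : 2 ^ 5 ≤ 2 ^ r := Nat.pow_le_pow_right (by norm_num) hr
      omega
    interval_cases M
    · refine ⟨1, 8, by norm_num, by norm_num, by norm_num, by norm_num, fun t ht => ⟨by omega, ?_⟩⟩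
      have := h5 (8 - t) (by omega)
      omega
    · refine ⟨2, 10, by norm_num, by norm_num, by norm_num, by norm_num, fun t ht => ⟨by omega, ?_⟩⟩
      have := h5 (10 - t) (by omega)
      omega
  · obtain ⟨c, hc⟩ : ∃ c, Nat.clog 2 M = c + 1 := by
      refine ⟨Nat.clog 2 M - 1, ?_⟩
      have := Nat.clog_pos (b := 2) (n := M) (by norm_num) (by omega)
      omega
    have h1 : M ≤ 2 ^ (c + 1) := hc ▸ Nat.le_pow_clog (by norm_num) M
    have h2 : 2 ^ c < M := by
      have := Nat.pow_pred_clog_lt_self (b := 2) (by norm_num) (x := M) (by omega)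
      rwa [hc] at this
    have h3 := seven_mul_le c
    have h4 : 1 ≤ c := by
      by_contra! h0
      have : c = 0 := by omega
      subst this
      omega
    have h6 : c < 2 ^ c := Nat.lt_two_pow_self
    have h7 : 2 ^ (c + 2) = 4 * 2 ^ c := by ring
    have h8 : 2 ^ (c + 1) = 2 * 2 ^ c := by ring
    refine ⟨c + 2, 4 * M + 6 - 2 * (c + 2), by omega, by omega, by omega, by omega,
      fun t ht => ⟨by omega, ?_⟩⟩
    have h9 := seven_mul_le_three_mul_two_pow h
    have h10 : 2 ^ M ≤ 2 ^ (4 * M + 6 - 2 * (c + 2) - t) :=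
      Nat.pow_le_pow_right (by norm_num) (by omega)
    omega

/-- If every proper sub-join-tree satisfies the potential trade-off between height and boundary,
then complete trees in the graph of a node survive, with bounded loss, in one of its children. -/
lemma exists_full_child {K h M : ℕ} {A : JoinTree Vtx} (hA : A.graph ⊆ TxFinset (K, 0))
    (hsmall : ∀ A', SubP A' A → ∀ n i, InTree K (n, i) → Full A'.graph n i →
      n + 3 * (boundary K A'.graph).card + 1 ≤ h + 3 * M)
    {B C : JoinTree Vtx} (hBC : Sub (node B C) A) {p v y : ℕ} (hpv : p + v ≤ h)
    (hnum : 3 * M + p + v + 1 ≤ 3 * 2 ^ v) (hz : InTree K (h - p, y))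
    (hfull : Full (node B C).graph (h - p) y) :
    ∃ i, Under (h - p - v, i) (h - p, y) ∧
      (Full B.graph (h - p - v) i ∨ Full C.graph (h - p - v) i) := by
  have hB := (graph_mono_of_sub (hBC.subP_left).1).trans hA
  have hC := (graph_mono_of_sub (hBC.subP_right).1).trans hA
  rw [graph_node] at hfull
  rcases full_union_cases hB hC hz hfull (Nat.sub_le (h - p) v) with h1 | ⟨H, hH, j, i, hj, hu, hf, hc⟩
  · exact h1
  · exfalso
    have hs : j + 3 * (boundary K H).card + 1 ≤ h + 3 * M := by
      rcases hH with rfl | rfl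
      · exact hsmall B hBC.subP_left j i (hu.inTree hz) hf
      · exact hsmall C hBC.subP_right j i (hu.inTree hz) hf
    have := le_three_mul_two_pow hnum (u := h - p - j - 1) (by omega)
    omega

/-- The trade-off between the height of a complete subtree, the size of the boundary and the
potential. -/
theorem height_add_boundary_le {K : ℕ} (hK : 2 ≤ K) {f : JoinTree Vtx → ℝ}
    (hf : PhiOk (↑(TxFinset (K, 0))) (thetaTk K) f) (A : JoinTree Vtx)
    (hA : A.graph ⊂ TxFinset (K, 0)) {h m : ℕ} (hz : InTree K (h, m)) (hfull : Full A.graph h m) :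
    (h : ℝ) + 3 * (boundary K A.graph).card - 3 ≤ 30 * f A := by
  induction hn : A.size using Nat.strong_induction_on generalizing A h m with
  | _ n ih =>
  subst hn
  obtain ⟨M, hMdef⟩ : ∃ M, (boundary K A.graph).card = M := ⟨_, rfl⟩
  rw [hMdef]
  have hM : 1 ≤ M := hMdef ▸ one_le_boundary_card hA hfull.mem_vset
  by_contra! hcon
  have hΔ : (M : ℝ) / 3 ≤ Delta (thetaTk K) A.graph := hMdef ▸ boundary_card_le_delta hK hA.1
  have hhM : 7 * M + 4 ≤ h := by
    have h1 := hf.delta_le hA.1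
    have h2 : (7 * M + 3 : ℝ) < h := by linarith
    exact_mod_cast h2
  have hproper : ∀ {D}, Sub D A → D.graph ⊂ TxFinset (K, 0) := fun hD =>
    lt_of_le_of_lt (graph_mono_of_sub hD) hA
  have hsmall : ∀ A', SubP A' A → ∀ n i, InTree K (n, i) → Full A'.graph n i →
      n + 3 * (boundary K A'.graph).card + 1 ≤ h + 3 * M := by
    intro A' hA' n i hni hfi
    have h1 := ih _ hA'.size_lt A' (hproper hA'.1) hni hfi rfl
    have h2 := hf.mono_of_sub hK hA.1 hA'.1 (nonempty_of_full hfi)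
    have h3 : (n + 3 * (boundary K A'.graph).card : ℝ) < h + 3 * M := by linarith
    have h4 : n + 3 * (boundary K A'.graph).card < h + 3 * M := by exact_mod_cast h3
    omega
  obtain ⟨s, τ, hs1, hτ, hs2, hs3, hs4⟩ := exists_scale hM
  -- the first sub-join-tree
  obtain ⟨D, hD, z, hzu, hzD, hDno⟩ : ∃ D, SubP D A ∧ ∃ z, Under (h - 2 * s, z) (h, m) ∧
      Full D.graph (h - 2 * s) z ∧ ∀ y, Under (h - s, y) (h, m) → ¬ Full D.graph (h - s) y := by
    obtain ⟨y₀, hy₀⟩ := exists_under (h - s) s m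
    rw [Nat.sub_add_cancel (by omega)] at hy₀
    obtain ⟨D₁, D₂, hsub, ⟨x, hxu, hx⟩, hn1, hn2⟩ := exists_minimal_node
      (fun X => ∃ y, Under (h - s, y) (h, m) ∧ Full X.graph (h - s) y)
      (fun l ⟨y, _, hy⟩ => by
        obtain ⟨q, hq⟩ : ∃ q, h - s = q + 1 := ⟨h - s - 1, by omega⟩
        rw [hq] at hy
        exact not_full_leaf l q y hy)
      (A := A) ⟨y₀, hy₀, hfull.under hy₀⟩
    push Not at hn1 hn2
    obtain ⟨i, hi, hi'⟩ := exists_full_child hA.1 hsmall hsub (p := s) (v := s) (by omega)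
      (by omega) (hxu.inTree hz) hx
    rw [show h - s - s = h - 2 * s by omega] at hi hi'
    rcases hi' with hi' | hi'
    · exact ⟨D₁, hsub.subP_left, i, hi.trans hxu, hi', hn1⟩
    · exact ⟨D₂, hsub.subP_right, i, hi.trans hxu, hi', hn2⟩
  -- an untouched complete subtree
  obtain ⟨w', hw'u, hw'⟩ : ∃ w', Under (h - s, w') (h, m) ∧
      ∀ v ∈ vset D.graph, ¬ Under v (h - s, w') := by
    by_contra! hall
    obtain ⟨q, rfl⟩ : ∃ q, h = q + s := ⟨h - s, by omega⟩
    rw [Nat.add_sub_cancel] at hall hDno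
    have h1 := (two_pow_le_boundaryUnder (hproper hD.1).1 hz fun i hi =>
      ⟨hall i hi, hDno i hi⟩).trans (boundaryUnder_card_le _ _ _)
    have h2 := hsmall D hD _ _ (hzu.inTree hz) hzD
    omega
  have hw'T := hw'u.inTree hz
  -- the second sub-join-tree
  obtain ⟨E₁, E₂, hE, ⟨y, hyu, hy⟩, hE1, hE2⟩ : ∃ E₁ E₂, SubP (node E₁ E₂) A ∧
      (∃ y, Under (h - τ, y) (h - s, w') ∧ Full (node E₁ E₂).graph (h - τ) y) ∧
      (∀ y, Under (h - τ, y) (h - s, w') → ¬ Full E₁.graph (h - τ) y) ∧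
      ∀ y, Under (h - τ, y) (h - s, w') → ¬ Full E₂.graph (h - τ) y := by
    obtain ⟨B, hB, i, hi, hi'⟩ : ∃ B, SubP B A ∧ ∃ i, Under (h - 2 * s, i) (h - s, w') ∧
        Full B.graph (h - 2 * s) i := by
      cases A with
      | leaf l =>
        obtain ⟨q, rfl⟩ : ∃ q, h = q + 1 := ⟨h - 1, by omega⟩
        exact absurd hfull (not_full_leaf l q m)
      | node B C =>
        obtain ⟨i, hi, hi'⟩ := exists_full_child hA.1 hsmall (Sub.refl _) (p := s) (v := s)
          (by omega) (by omega) hw'T (hfull.under hw'u)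
        rw [show h - s - s = h - 2 * s by omega] at hi hi'
        rcases hi' with hi' | hi'
        · exact ⟨B, (Sub.refl _).subP_left, i, hi, hi'⟩
        · exact ⟨C, (Sub.refl _).subP_right, i, hi, hi'⟩
    obtain ⟨y₀, hy₀⟩ := exists_under (h - τ) (τ - 2 * s) i
    rw [show h - τ + (τ - 2 * s) = h - 2 * s by omega] at hy₀
    obtain ⟨E₁, E₂, hsub, hP, hn1, hn2⟩ := exists_minimal_node
      (fun X => ∃ y, Under (h - τ, y) (h - s, w') ∧ Full X.graph (h - τ) y)
      (fun l ⟨y, _, hy⟩ => by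
        obtain ⟨q, hq⟩ : ∃ q, h - τ = q + 1 := ⟨h - τ - 1, by omega⟩
        rw [hq] at hy
        exact not_full_leaf l q y hy)
      (A := B) ⟨y₀, hy₀.trans hi, hi'.under hy₀⟩
    push Not at hn1 hn2
    exact ⟨E₁, E₂, (hsub.trans hB.1).subP_of_size_lt (hsub.size_le.trans_lt hB.size_lt), hP,
      hn1, hn2⟩
  obtain ⟨E, hEdef⟩ : ∃ E, E = node E₁ E₂ := ⟨_, rfl⟩
  rw [← hEdef] at hE hy
  have hEF := (hproper hE.1).1
  -- a maximal complete subtree of its graph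
  obtain ⟨w, hwu, hw, hwmax⟩ : ∃ w : Vtx, Under w (h - s, w') ∧ Full E.graph w.1 w.2 ∧
      ∀ y : Vtx, Under y (h - s, w') → Full E.graph y.1 y.2 → y.1 ≤ w.1 := by
    let P : ℕ → Prop := fun l => ∃ i, Under (l, i) (h - s, w') ∧ Full E.graph l i
    have hP : P (h - τ) := ⟨y, hyu, hy⟩
    have hb : ∀ l, P l → l ≤ h := fun l ⟨i, hi, _⟩ => by
      have := hi.le
      simp only at this
      omega
    obtain ⟨i, hi, hi'⟩ := Nat.findGreatest_spec (P := P) (hb _ hP) hP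
    exact ⟨(_, i), hi, hi', fun y hy hy' =>
      Nat.le_findGreatest (P := P) (hb _ ⟨y.2, hy, hy'⟩) ⟨y.2, hy, hy'⟩⟩
  have hwτ : h - τ ≤ w.1 := hwmax (h - τ, y) hyu hy
  have hws : w.1 ≤ h - s := hwu.le
  obtain ⟨t, ht⟩ : ∃ t, w.1 + t = h := ⟨h - w.1, by omega⟩
  by_cases hreach : ∃ d ∈ vset D.graph,
      (SimpleGraph.fromEdgeSet (E.graph : Set (Sym2 Vtx))).Reachable w d
  · obtain ⟨d, hd, hwd⟩ := hreach
    obtain ⟨r, hr⟩ := hwu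
    have hrt : r = t - s := by
      have := iterate_parentV_fst r w
      rw [hr] at this
      simp only at this
      omega
    have hedge : ∀ j < r, parentEdge (parentV^[j] w) ∈ E.graph := by
      intro j hj
      by_contra hne
      have h1 : Under d (parentV^[j] w) := under_of_reachable hEF hne ⟨j, rfl⟩ hwd
      refine hw' d hd (h1.trans ⟨r - j, ?_⟩)
      rw [← Function.iterate_add_apply, Nat.sub_add_cancel hj.le, hr]
    have h1 := (le_boundaryUnder_of_path hEF hw'T hw hwmax r (hr ▸ Under.rfl' _) hedge).trans
      (boundaryUnder_card_le _ _ _)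
    have hwu : Under w (h - s, w') := ⟨r, hr⟩
    have h2 := hsmall E hE _ _ (hwu.inTree hw'T) hw
    obtain ⟨htτ, hpow⟩ := hs4 t (by omega)
    have hw1 : w = (h - t, w.2) := Prod.ext (by simp only; omega) rfl
    rw [hw1] at hwu hw
    subst hEdef
    obtain ⟨i, hi, hi'⟩ := exists_full_child hA.1 hsmall hE.1 (p := t) (v := τ - t) (by omega)
      (by omega) (hwu.inTree hw'T) hw
    rw [show h - t - (τ - t) = h - τ by omega] at hi hi'
    rcases hi' with hi' | hi'
    · exact hE1 i (hi.trans hwu) hi'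
    · exact hE2 i (hi.trans hwu) hi'
  · push Not at hreach
    have h1 : Full (elimT E (vset D.graph)).graph w.1 w.2 := by
      rw [graph_elimT]
      exact hw.elimS hreach
    have hprop : (elimT E (vset D.graph)).graph ⊂ TxFinset (K, 0) := by
      rw [graph_elimT]
      exact lt_of_le_of_lt (elimS_subset _ _) (hproper hE.1)
    have h2 := ih _ ((size_prune_le E _).trans_lt hE.size_lt) _ hprop (hwu.inTree hw'T) h1 rfl
    have h3 := ih _ hD.size_lt D (hproper hD.1) (hzu.inTree hz) hzD rfl
    have h4 := hf.2.2.2.2 A D E (Finset.coe_subset.2 hA.1) hD hE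
    have h5 := delta_nonneg hK
      ((elimS_subset A.graph (vset D.graph ∪ vset E.graph)).trans hA.1)
    have h6 : (1 : ℝ) ≤ (boundary K D.graph).card := by
      exact_mod_cast one_le_boundary_card (hproper hD.1) hzD.mem_vset
    have h7 : (1 : ℝ) ≤ (boundary K (elimT E (vset D.graph)).graph).card := by
      exact_mod_cast one_le_boundary_card hprop h1.mem_vset
    have h8 : (h : ℝ) ≤ w.1 + τ := by exact_mod_cast (by omega : h ≤ w.1 + τ)
    have h9 : (((h - 2 * s : ℕ)) : ℝ) = h - 2 * s := by
      rw [Nat.cast_sub (by omega)]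
      push_cast
      ring
    have h10 : (τ : ℝ) + 2 * s = 4 * M + 6 := by exact_mod_cast hτ
    rw [h9] at h3
    linarith

lemma le_of_phiOk {k : ℕ} (hk : 2 ≤ k) {f : JoinTree Vtx → ℝ}
    (hf : PhiOk (↑(TxFinset (k, 0))) (thetaTk k) f) {A : JoinTree Vtx}
    (hA : A.graph = TxFinset (k, 0)) : (k : ℝ) / 30 - 1 / 5 ≤ f A := by
  rcases le_or_gt k 6 with hk6 | hk6
  · have h1 := hf.1 A (Finset.coe_subset.2 hA.subset)
    have h2 : (k : ℝ) ≤ 6 := by exact_mod_cast hk6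
    linarith
  have hfull := full_TxFinset (K := k) (by omega)
  suffices h : ∃ X, Sub X A ∧ X.graph.Nonempty ∧ (k : ℝ) - 6 ≤ 30 * f X by
    obtain ⟨X, hX, hne, hle⟩ := h
    have := hf.mono_of_sub hk hA.subset hX hne
    linarith
  obtain ⟨B, C, hBC, hg, hB, hC⟩ := exists_minimal_node (fun X => X.graph = TxFinset (k, 0))
    (fun l hl => by
      obtain ⟨q, rfl⟩ : ∃ q, k = q + 1 := ⟨k - 1, by omega⟩
      rw [← hl] at hfull
      exact not_full_leaf l q 0 hfull) hA
  have hBs : Sub B A := hBC.subP_left.1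
  have hCs : Sub C A := hBC.subP_right.1
  have hBp : B.graph ⊂ TxFinset (k, 0) :=
    lt_of_le_of_ne (hA ▸ graph_mono_of_sub hBs) hB
  have hCp : C.graph ⊂ TxFinset (k, 0) :=
    lt_of_le_of_ne (hA ▸ graph_mono_of_sub hCs) hC
  have hchild : ∃ X, (X = B ∨ X = C) ∧ ∃ j i, Under (j, i) (k, 0) ∧ Full X.graph j i ∧
      k ≤ j + 3 + 3 * (boundary k X.graph).card := by
    have key := hfull
    rw [← hg, graph_node] at key
    rcases full_union_cases hBp.1 hCp.1 (inTree_root k) key (Nat.sub_le k 6) with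
      ⟨i, hi, h | h⟩ | ⟨H, hH, j, i, hj, hu, hf', hc⟩
    · have := one_le_boundary_card hBp h.mem_vset
      exact ⟨B, Or.inl rfl, _, i, hi, h, by omega⟩
    · have := one_le_boundary_card hCp h.mem_vset
      exact ⟨C, Or.inr rfl, _, i, hi, h, by omega⟩
    · have := Nat.lt_two_pow_self (n := k - j - 1)
      rcases hH with rfl | rfl
      · exact ⟨B, Or.inl rfl, j, i, hu, hf', by omega⟩
      · exact ⟨C, Or.inr rfl, j, i, hu, hf', by omega⟩
  obtain ⟨X, hX, j, i, hu, hXf, hle⟩ := hchild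
  have hXs : Sub X A := by rcases hX with rfl | rfl <;> assumption
  have hXp : X.graph ⊂ TxFinset (k, 0) := by rcases hX with rfl | rfl <;> assumption
  refine ⟨X, hXs, nonempty_of_full hXf, ?_⟩
  have h1 := height_add_boundary_le hk hf X hXp (hu.inTree (inTree_root k)) hXf
  have h2 : (k : ℝ) ≤ j + 3 + 3 * (boundary k X.graph).card := by exact_mod_cast hle
  linarith

/-- Let `k ≥ 2` and let `θ'` be the threshold weighting on the
complete binary tree `T_k` arising from the uniform random walk on `T_k`. Then for
every join-tree `A` over `T_k` whose graph equals `T_k`,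
`Φ_{θ'}(A) ≥ k/30 − 1/5`. -/
theorem stmt9 (k : ℕ) (hk : 2 ≤ k) (A : JoinTree Vtx)
    (hA : A.graph = TxFinset (k, 0)) :
    (k : ℝ) / 30 - 1 / 5 ≤ Phi (↑(TxFinset (k, 0))) (thetaTk k) A := by
  obtain ⟨f, hf⟩ := exists_phiOk hk
  refine le_csInf ⟨_, f, hf, rfl⟩ ?_
  rintro y ⟨g, hg, rfl⟩
  exact le_of_phiOk hk hg hA

end Paper

end
end
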